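/- arXiv:1205.0314 — 7 statements merged into one kernel-verified Lean document; each statement's English description precedes it below -/
import Mathlib

section
/- Let f : F_2^n → F_2 and 0 ≤ ε. If Pr_{x,y}[f(x) + f(y) = f(x+y)] ≥ 1 − ε, where x and y are independent uniform elements of F_2^n, then there exists a set S ⊆ {1,…,n} such that Pr_x[f(x) ≠ Σ_{i∈S} x_i] ≤ ε; i.e., f is ε-close in normalized Hamming distance to some F_2-linear function. -/
open Finset

/-- The nontrivial character of `𝔽₂` with values in `ℝ`. -/
def signChar (a : ZMod 2) : ℝ := if a = 0 then 1 else -1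

lemma signChar_zero : signChar 0 = 1 := by simp [signChar]

lemma eq_zero_or_eq_one_of_zmod_two (a : ZMod 2) : a = 0 ∨ a = 1 := by
  revert a; decide

lemma signChar_add (a b : ZMod 2) : signChar (a + b) = signChar a * signChar b := by
  have two : (1 : ZMod 2) + 1 = 0 := by decide
  rcases eq_zero_or_eq_one_of_zmod_two a with rfl | rfl <;>
    rcases eq_zero_or_eq_one_of_zmod_two b with rfl | rfl <;> simp [signChar, two]

lemma signChar_mul_self (a : ZMod 2) : signChar a * signChar a = 1 := by
  unfold signChar; split_ifs <;> norm_num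

lemma signChar_mul_signChar (a b : ZMod 2) :
    signChar a * signChar b = 1 - 2 * (if a ≠ b then (1 : ℝ) else 0) := by
  rcases eq_zero_or_eq_one_of_zmod_two a with rfl | rfl <;>
    rcases eq_zero_or_eq_one_of_zmod_two b with rfl | rfl <;> norm_num [signChar]

lemma signChar_sum {ι : Type*} (S : Finset ι) (x : ι → ZMod 2) :
    signChar (∑ i ∈ S, x i) = ∏ i ∈ S, signChar (x i) := by
  classical
  induction S using Finset.induction_on with
  | empty => simp [signChar_zero]
  | insert a s ha ih => rw [sum_insert ha, prod_insert ha, signChar_add, ih]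

/-- The Walsh character indexed by `S`. -/
def walsh {n : ℕ} (S : Finset (Fin n)) (x : Fin n → ZMod 2) : ℝ := signChar (∑ i ∈ S, x i)

lemma walsh_add {n : ℕ} (S : Finset (Fin n)) (x y : Fin n → ZMod 2) :
    walsh S (x + y) = walsh S x * walsh S y := by
  simp only [walsh, Pi.add_apply, sum_add_distrib, signChar_add]

lemma sum_walsh {n : ℕ} (x : Fin n → ZMod 2) :
    ∑ S : Finset (Fin n), walsh S x = if x = 0 then (2 : ℝ) ^ n else 0 := by
  have key : ∑ S : Finset (Fin n), walsh S x = ∏ i, (1 + signChar (x i)) := by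
    rw [prod_one_add, powerset_univ]
    exact sum_congr rfl fun S _ => signChar_sum S x
  rw [key]
  split_ifs with hx
  · subst hx
    norm_num [signChar_zero]
  · obtain ⟨i, hi⟩ := Function.ne_iff.mp hx
    refine prod_eq_zero (mem_univ i) ?_
    have hi' : x i ≠ 0 := hi
    simp [signChar, hi']

lemma add_eq_zero_iff_eq_of_zmod_two {n : ℕ} (x y : Fin n → ZMod 2) : x + y = 0 ↔ x = y := by
  rw [add_eq_zero_iff_eq_neg]
  have hy : -y = y := by
    funext i
    exact ZMod.neg_eq_self_mod_two (y i)
  rw [hy]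

/-- Parseval's identity for unnormalized Walsh coefficients. -/
lemma sum_walsh_coeff_sq {n : ℕ} (F : (Fin n → ZMod 2) → ℝ) :
    ∑ S : Finset (Fin n), (∑ x, F x * walsh S x) ^ 2 = 2 ^ n * ∑ x, F x * F x := by
  calc ∑ S : Finset (Fin n), (∑ x, F x * walsh S x) ^ 2
      = ∑ S : Finset (Fin n), ∑ x, ∑ y, F x * F y * walsh S (x + y) := by
        refine sum_congr rfl fun S _ => ?_
        rw [sq, sum_mul_sum]
        refine sum_congr rfl fun x _ => sum_congr rfl fun y _ => ?_
        rw [walsh_add]; ring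
    _ = ∑ x, ∑ y, F x * F y * ∑ S : Finset (Fin n), walsh S (x + y) := by
        rw [sum_comm]
        refine sum_congr rfl fun x _ => ?_
        rw [sum_comm]
        exact sum_congr rfl fun y _ => (mul_sum ..).symm
    _ = 2 ^ n * ∑ x, F x * F x := by
        simp only [sum_walsh, add_eq_zero_iff_eq_of_zmod_two, mul_ite, mul_zero,
          sum_ite_eq, mem_univ, if_true]
        rw [← sum_mul, mul_comm]

lemma sum_walsh_coeff_cube {n : ℕ} (F : (Fin n → ZMod 2) → ℝ) :
    ∑ S : Finset (Fin n), (∑ x, F x * walsh S x) ^ 3 =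
      2 ^ n * ∑ x, ∑ y, F x * F y * F (x + y) := by
  calc ∑ S : Finset (Fin n), (∑ x, F x * walsh S x) ^ 3
      = ∑ S : Finset (Fin n), ∑ x, ∑ y, ∑ z, F x * F y * F z * walsh S (x + y + z) := by
        refine sum_congr rfl fun S _ => ?_
        rw [pow_succ, sq, sum_mul_sum, sum_mul]
        refine sum_congr rfl fun x _ => ?_
        rw [sum_mul]
        refine sum_congr rfl fun y _ => ?_
        rw [mul_sum]
        refine sum_congr rfl fun z _ => ?_
        rw [walsh_add, walsh_add]; ring
    _ = ∑ x, ∑ y, ∑ z, F x * F y * F z * ∑ S : Finset (Fin n), walsh S (x + y + z) := by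
        rw [sum_comm]
        refine sum_congr rfl fun x _ => ?_
        rw [sum_comm]
        refine sum_congr rfl fun y _ => ?_
        rw [sum_comm]
        exact sum_congr rfl fun z _ => (mul_sum ..).symm
    _ = 2 ^ n * ∑ x, ∑ y, F x * F y * F (x + y) := by
        simp only [sum_walsh, add_eq_zero_iff_eq_of_zmod_two, mul_ite, mul_zero,
          sum_ite_eq, mem_univ, if_true]
        simp only [← sum_mul]
        rw [mul_comm]

/-- **BLR soundness.** If `f : 𝔽₂ⁿ → 𝔽₂` passes the BLR linearity test with probability
at least `1 - ε`, then `f` is `ε`-close in normalized Hamming distance to some linear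
function `x ↦ ∑_{i ∈ S} x i`. -/
theorem blr_soundness (n : ℕ) (f : (Fin n → ZMod 2) → ZMod 2) (ε : ℝ) (hε : 0 ≤ ε)
    (h : (1 : ℝ) - ε ≤
      (∑ x : Fin n → ZMod 2, ∑ y : Fin n → ZMod 2,
        if f x + f y = f (x + y) then (1 : ℝ) else 0) / 4 ^ n) :
    ∃ S : Finset (Fin n),
      (∑ x : Fin n → ZMod 2, if f x ≠ ∑ i ∈ S, x i then (1 : ℝ) else 0) / 2 ^ n ≤ ε := by
  have hN : (0 : ℝ) < 2 ^ n := by positivity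
  have h4 : (4 : ℝ) ^ n = 2 ^ n * 2 ^ n := by rw [← mul_pow]; norm_num
  have hcard : ∑ _x : Fin n → ZMod 2, (1 : ℝ) = 2 ^ n := by simp
  rw [h4, le_div_iff₀ (by positivity)] at h
  by_contra! hfar
  have hcoeff (S : Finset (Fin n)) :
      ∑ x, signChar (f x) * walsh S x < (1 - 2 * ε) * 2 ^ n := by
    have hS := hfar S
    rw [lt_div_iff₀ hN] at hS
    simp only [walsh, signChar_mul_signChar, sum_sub_distrib, ← mul_sum, hcard]
    linarith
  have hsq := sum_walsh_coeff_sq fun x => signChar (f x)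
  simp only [signChar_mul_self, hcard] at hsq
  have hcube := sum_walsh_coeff_cube fun x => signChar (f x)
  have hpass : ∑ x, ∑ y, signChar (f x) * signChar (f y) * signChar (f (x + y)) =
      2 * (∑ x : Fin n → ZMod 2, ∑ y : Fin n → ZMod 2,
        if f x + f y = f (x + y) then (1 : ℝ) else 0) - 2 ^ n * 2 ^ n := by
    have hone : (2 : ℝ) ^ n * 2 ^ n =
        ∑ _x : Fin n → ZMod 2, ∑ _y : Fin n → ZMod 2, (1 : ℝ) := by simp
    rw [hone]
    simp only [mul_sum, ← sum_sub_distrib]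
    refine sum_congr rfl fun x _ => sum_congr rfl fun y _ => ?_
    rw [← signChar_add, signChar_mul_signChar, ite_not]
    split_ifs <;> norm_num
  have hlt : ∑ S : Finset (Fin n), (∑ x, signChar (f x) * walsh S x) ^ 3 <
      ∑ S : Finset (Fin n), (1 - 2 * ε) * 2 ^ n * (∑ x, signChar (f x) * walsh S x) ^ 2 := by
    refine sum_lt_sum (fun S _ => ?_) ?_
    · rw [pow_succ']
      exact mul_le_mul_of_nonneg_right (hcoeff S).le (sq_nonneg _)
    · have hpos : ∑ _S : Finset (Fin n), (0 : ℝ) <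
          ∑ S : Finset (Fin n), (∑ x, signChar (f x) * walsh S x) ^ 2 := by
        rw [hsq, sum_const_zero]; positivity
      obtain ⟨S, hS, hSpos⟩ := exists_lt_of_sum_lt hpos
      refine ⟨S, hS, ?_⟩
      rw [pow_succ']
      exact mul_lt_mul_of_pos_right (hcoeff S) hSpos
  rw [← mul_sum, hsq, hcube, hpass] at hlt
  have := mul_le_mul_of_nonneg_left h hN.le
  linarith
end

section
/- Let f : {-1,1}^n → {-1,1}. Let (x,y,z) be random strings in {-1,1}^n whose coordinate triples (x_i, y_i, z_i), i = 1,…,n, are independent and each uniformly distributed over the 6 elements of {-1,1}^3 that are not all equal. Then E[NAE(f(x), f(y), f(z))] = 3/4 − (3/4)·Stab_{−1/3}(f) = 3/4 − (3/4)·Σ_{S ⊆ [n]} (−1/3)^{|S|} f̂(S)^2. -/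
open Finset

/-- The real value of a cube coordinate: `true ↦ 1`, `false ↦ -1`. -/
noncomputable def bR (b : Bool) : ℝ := if b then 1 else -1

/-- Expectation over a uniformly random point of the cube `{-1,1}ⁿ`. -/
noncomputable def expect {n : ℕ} (g : (Fin n → Bool) → ℝ) : ℝ :=
  (∑ x : Fin n → Bool, g x) / 2 ^ n

/-- The character `χ_S(x) = ∏_{i ∈ S} x i`. -/
noncomputable def chi {n : ℕ} (S : Finset (Fin n)) (x : Fin n → Bool) : ℝ :=
  ∏ i ∈ S, bR (x i)

/-- The Fourier coefficient `f̂(S) = E[f(x) χ_S(x)]`. -/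
noncomputable def fhat {n : ℕ} (f : (Fin n → Bool) → ℝ) (S : Finset (Fin n)) : ℝ :=
  expect fun x => f x * chi S x

/-- The weight of the NAE distribution on a coordinate triple: uniform over the 6
triples in `{-1,1}³` that are not all equal. -/
noncomputable def naeWeight {n : ℕ} (x y z : Fin n → Bool) : ℝ :=
  ∏ i, if x i = y i ∧ y i = z i then 0 else (1 / 6 : ℝ)

/-- `NAE(a,b,c) ∈ {0,1}`: `1` iff the three arguments are not all equal. -/
noncomputable def naeR (a b c : ℝ) : ℝ := if a = b ∧ b = c then 0 else 1

lemma sum_pi_prod {n : ℕ} (g : Fin n → Bool → ℝ) :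
    ∑ z : Fin n → Bool, ∏ i, g i (z i) = ∏ i, (g i true + g i false) := by
  simp only [← Fintype.sum_bool, Finset.prod_univ_sum, Fintype.piFinset_univ]

/-- The joint law of two coordinates of an NAE triple. -/
noncomputable def pairWeight {n : ℕ} (x y : Fin n → Bool) : ℝ :=
  ∏ i, if x i = y i then (1 / 6 : ℝ) else 1 / 3

lemma sum_naeWeight {n : ℕ} (x y : Fin n → Bool) :
    ∑ z, naeWeight x y z = pairWeight x y := by
  unfold naeWeight pairWeight
  rw [sum_pi_prod fun i b => if x i = y i ∧ y i = b then 0 else (1 / 6 : ℝ)]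
  refine Finset.prod_congr rfl fun i _ => ?_
  cases x i <;> cases y i <;> norm_num

lemma naeWeight_rotate {n : ℕ} (x y z : Fin n → Bool) :
    naeWeight x y z = naeWeight y z x := by
  unfold naeWeight
  refine Finset.prod_congr rfl fun i _ => ?_
  cases x i <;> cases y i <;> cases z i <;> simp

lemma sum_pairWeight {n : ℕ} (x : Fin n → Bool) : ∑ y, pairWeight x y = 1 / 2 ^ n := by
  unfold pairWeight
  rw [sum_pi_prod fun i b => if x i = b then (1 / 6 : ℝ) else 1 / 3]
  calc _ = ∏ _i : Fin n, (1 / 2 : ℝ) := by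
        refine Finset.prod_congr rfl fun i _ => ?_
        cases x i <;> norm_num
    _ = _ := by simp

lemma sum_sum_pairWeight (n : ℕ) : ∑ x : Fin n → Bool, ∑ y, pairWeight x y = 1 := by
  simp [sum_pairWeight]

lemma pairWeight_eq_sum_chi {n : ℕ} (x y : Fin n → Bool) :
    pairWeight x y =
      ∑ S : Finset (Fin n), (-1 / 3 : ℝ) ^ S.card * (chi S x / 2 ^ n) * (chi S y / 2 ^ n) := by
  calc pairWeight x y = ∏ i, (1 / 4 : ℝ) * (1 + -1 / 3 * (bR (x i) * bR (y i))) := by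
        refine Finset.prod_congr rfl fun i _ => ?_
        cases x i <;> cases y i <;> norm_num [bR]
    _ = _ := by
        rw [Finset.prod_mul_distrib, Finset.prod_one_add, Finset.mul_sum, Finset.powerset_univ]
        refine Finset.sum_congr rfl fun S _ => ?_
        have h : (4 : ℝ) ^ n = 2 ^ n * 2 ^ n := by rw [← mul_pow]; norm_num
        simp only [Finset.prod_mul_distrib, Finset.prod_const, Finset.card_univ,
          Fintype.card_fin, one_div, inv_pow, h, chi]
        field_simp

lemma sum_pairWeight_mul {n : ℕ} (f : (Fin n → Bool) → ℝ) :
    ∑ x, ∑ y, pairWeight x y * (f x * f y) =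
      ∑ S : Finset (Fin n), (-1 / 3 : ℝ) ^ S.card * fhat f S ^ 2 := by
  simp only [pairWeight_eq_sum_chi, Finset.sum_mul]
  rw [Finset.sum_congr rfl fun x _ => Finset.sum_comm, Finset.sum_comm]
  refine Finset.sum_congr rfl fun S _ => ?_
  unfold fhat _root_.expect
  rw [sq, Finset.sum_div, Finset.sum_mul_sum, Finset.mul_sum]
  refine Finset.sum_congr rfl fun x _ => ?_
  rw [Finset.mul_sum]
  refine Finset.sum_congr rfl fun y _ => ?_
  ring

lemma naeR_eq {a b c : ℝ} (ha : a = 1 ∨ a = -1) (hb : b = 1 ∨ b = -1) (hc : c = 1 ∨ c = -1) :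
    naeR a b c = 3 / 4 - 1 / 4 * (a * b) - 1 / 4 * (b * c) - 1 / 4 * (c * a) := by
  rcases ha with rfl | rfl <;> rcases hb with rfl | rfl <;> rcases hc with rfl | rfl <;>
    norm_num [naeR]

/-- Summing out the third voter reduces to the pair law. -/
lemma sum_naeWeight_mul {n : ℕ} (g : (Fin n → Bool) → (Fin n → Bool) → ℝ) :
    ∑ x, ∑ y, ∑ z, naeWeight x y z * g x y = ∑ x, ∑ y, pairWeight x y * g x y := by
  simp only [← Finset.sum_mul, sum_naeWeight]

lemma sum_rotate {n : ℕ} (g : (Fin n → Bool) → (Fin n → Bool) → (Fin n → Bool) → ℝ) :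
    ∑ x, ∑ y, ∑ z, naeWeight x y z * g x y z =
      ∑ x, ∑ y, ∑ z, naeWeight x y z * g z x y := by
  conv_lhs => enter [2, x, 2, y, 2, z]; rw [naeWeight_rotate]
  rw [Finset.sum_comm]
  refine Finset.sum_congr rfl fun y _ => ?_
  rw [Finset.sum_comm]

/-- **Kalai's formula.** If the voters' preference triples are i.i.d. uniform over NAE
triples, then `E[NAE(f(x), f(y), f(z))] = 3/4 - (3/4)·Stab_{-1/3}(f)
= 3/4 - (3/4)·∑_S (-1/3)^{|S|} f̂(S)²`. -/
theorem kalai_nae_formula (n : ℕ) (f : (Fin n → Bool) → ℝ)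
    (hbool : ∀ x, f x = 1 ∨ f x = -1) :
    (∑ x : Fin n → Bool, ∑ y : Fin n → Bool, ∑ z : Fin n → Bool,
        naeWeight x y z * naeR (f x) (f y) (f z)) =
      3 / 4 - 3 / 4 * ∑ S : Finset (Fin n), (-1 / 3 : ℝ) ^ S.card * fhat f S ^ 2 := by
  have hxy := sum_naeWeight_mul fun x y => f x * f y
  have hyz := (sum_rotate fun _ y z => f y * f z).trans hxy
  have hzx := (sum_rotate fun x _ z => f z * f x).trans
    ((sum_rotate fun _ y z => f y * f z).trans hxy)
  have hone := sum_naeWeight_mul (n := n) fun _ _ => 1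
  rw [sum_pairWeight_mul] at hxy hyz hzx
  simp only [mul_one, sum_sum_pairWeight] at hone
  calc _ = 3 / 4 * (∑ x : Fin n → Bool, ∑ y : Fin n → Bool, ∑ z, naeWeight x y z)
        - 1 / 4 * (∑ x, ∑ y, ∑ z, naeWeight x y z * (f x * f y))
        - 1 / 4 * (∑ x, ∑ y, ∑ z, naeWeight x y z * (f y * f z))
        - 1 / 4 * (∑ x, ∑ y, ∑ z, naeWeight x y z * (f z * f x)) := by
        simp only [Finset.mul_sum, ← Finset.sum_sub_distrib]
        refine Finset.sum_congr rfl fun x _ => Finset.sum_congr rfl fun y _ =>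
          Finset.sum_congr rfl fun z _ => ?_
        rw [naeR_eq (hbool x) (hbool y) (hbool z)]
        ring
    _ = _ := by
        rw [hone, hxy, hyz, hzx]
        ring
end

section
/- Sheppard's formula: let ρ ∈ [−1,1], let G and G' be independent standard one-dimensional Gaussian random variables, and set H = ρ·G + √(1−ρ^2)·G'. Then Pr[sgn(G) ≠ sgn(H)] = arccos(ρ)/π. -/
open MeasureTheory ProbabilityTheory

/-- `sgn(t)`: `1` if `t > 0`, `-1` otherwise. -/
noncomputable def sgn (t : ℝ) : ℝ := if 0 < t then 1 else -1

open Real Set in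
lemma gaussianPDF_mul_cos_mul_sin (r θ : ℝ) :
    gaussianPDF 0 1 (r * cos θ) * gaussianPDF 0 1 (r * sin θ) =
      gaussianPDF 0 1 r * gaussianPDF 0 1 0 := by
  simp only [gaussianPDF, ← ENNReal.ofReal_mul (gaussianPDFReal_nonneg _ _ _)]
  simp only [gaussianPDFReal]
  congr 1
  rw [mul_mul_mul_comm, mul_mul_mul_comm _ (rexp (-(r - 0) ^ 2 / _)), ← Real.exp_add,
    ← Real.exp_add]
  congr 2
  simp only [sub_zero, NNReal.coe_one]
  linear_combination -r ^ 2 / 2 * sin_sq_add_cos_sq θ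

open Real Set in
/-- The standard Gaussian measure on the plane of a cone is proportional to its angular size. -/
lemma gaussianReal_prod_cone_eq_const_mul {S : Set (ℝ × ℝ)} {A : Set ℝ} (hS : MeasurableSet S)
    (hA : MeasurableSet A) (h : ∀ r > 0, ∀ θ, (r * cos θ, r * sin θ) ∈ S ↔ θ ∈ A) :
    (gaussianReal 0 1).prod (gaussianReal 0 1) S =
      (∫⁻ r in Ioi 0, ENNReal.ofReal r * (gaussianPDF 0 1 r * gaussianPDF 0 1 0)) *
        volume (A ∩ Ioo (-π) π) := by
  have hm := measurable_gaussianPDF 0 1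
  rw [gaussianReal_of_var_ne_zero _ one_ne_zero, prod_withDensity hm hm,
    withDensity_apply _ hS, ← lintegral_indicator hS, ← Measure.volume_eq_prod,
    ← lintegral_comp_polarCoord_symm, polarCoord_target]
  calc
    _ = ∫⁻ p in Ioi (0 : ℝ) ×ˢ Ioo (-π) π,
        (ENNReal.ofReal p.1 * (gaussianPDF 0 1 p.1 * gaussianPDF 0 1 0)) *
          A.indicator 1 p.2 := by
      refine setLIntegral_congr_fun (measurableSet_Ioi.prod measurableSet_Ioo) ?_
      rintro ⟨r, θ⟩ ⟨hr, -⟩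
      by_cases hθ : θ ∈ A
      · simp [polarCoord_symm_apply, indicator_of_mem ((h r hr θ).2 hθ), hθ,
          gaussianPDF_mul_cos_mul_sin]
      · simp [polarCoord_symm_apply, indicator_of_notMem (mt (h r hr θ).1 hθ), hθ]
    _ = _ := by
      rw [Measure.volume_eq_prod, ← Measure.prod_restrict, lintegral_prod_mul
        (f := fun r ↦ ENNReal.ofReal r * (gaussianPDF 0 1 r * gaussianPDF 0 1 0)) (by fun_prop)
        ((measurable_one.indicator hA).aemeasurable), lintegral_indicator_one hA,
        Measure.restrict_apply hA]

open Real Set in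
lemma gaussianReal_prod_cone {S : Set (ℝ × ℝ)} {A : Set ℝ} (hS : MeasurableSet S)
    (hA : MeasurableSet A) (h : ∀ r > 0, ∀ θ, (r * cos θ, r * sin θ) ∈ S ↔ θ ∈ A) :
    (gaussianReal 0 1).prod (gaussianReal 0 1) S =
      volume (A ∩ Ioo (-π) π) / ENNReal.ofReal (2 * π) := by
  have huniv := gaussianReal_prod_cone_eq_const_mul MeasurableSet.univ MeasurableSet.univ
    (fun _ _ _ ↦ by simp)
  rw [measure_univ, univ_inter, volume_Ioo, sub_neg_eq_add, ← two_mul] at huniv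
  rw [gaussianReal_prod_cone_eq_const_mul hS hA h, ENNReal.eq_inv_of_mul_eq_one_left huniv.symm,
    mul_comm, div_eq_mul_inv]

open Real Set in
/-- The directions separated by the half-planes `0 < x` and `0 < x * cos α + y * sin α`, up to two
boundary directions. -/
lemma setOf_cos_pos_ne_inter_Ioo_sdiff {α : ℝ} (h0 : 0 ≤ α) (hπ : α ≤ π) :
    ({θ | ¬(0 < cos θ ↔ 0 < cos (θ - α))} ∩ Ioo (-π) π) \ {α - π / 2, π / 2} =
      Ioo (-π) (α - 3 * π / 2) ∪ (Ioo (-(π / 2)) (α - π / 2) ∪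
        Ioo (π / 2) (min π (α + π / 2))) := by
  have hp := pi_pos
  ext θ
  simp only [mem_inter_iff, mem_ofPred_eq, mem_union, mem_sdiff, mem_insert_iff,
    mem_singleton_iff, mem_Ioo, lt_min_iff]
  by_cases hθ : -π < θ ∧ θ < π
  · obtain ⟨h1, h2⟩ := hθ
    have hG : 0 < cos θ ↔ -(π / 2) < θ ∧ θ < π / 2 := by
      refine ⟨fun h ↦ ⟨?_, ?_⟩, cos_pos_of_mem_Ioo⟩ <;> by_contra! hc
      · have := cos_nonpos_of_pi_div_two_le_of_le (x := -θ) (by linarith) (by linarith)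
        rw [cos_neg] at this; linarith
      · have := cos_nonpos_of_pi_div_two_le_of_le (x := θ) (by linarith) (by linarith)
        linarith
    have hH : 0 < cos (θ - α) ↔
        (α - π / 2 < θ ∧ θ < α + π / 2) ∨ θ < α - 3 * π / 2 := by
      constructor
      · contrapose!
        rintro ⟨h3, h4⟩
        rcases le_or_gt θ (α - π / 2) with h5 | h5
        · rw [← cos_neg]
          exact cos_nonpos_of_pi_div_two_le_of_le (by linarith) (by linarith)
        · exact cos_nonpos_of_pi_div_two_le_of_le (by linarith [h3 h5]) (by linarith [h3 h5])
      · rintro (h | h)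
        · exact cos_pos_of_mem_Ioo ⟨by linarith, by linarith⟩
        · rw [← cos_add_two_pi]
          exact cos_pos_of_mem_Ioo ⟨by linarith, by linarith⟩
    rw [hG, hH]
    grind
  · grind

open Real Set in
lemma volume_setOf_cos_pos_ne_inter_Ioo {α : ℝ} (h0 : 0 ≤ α) (hπ : α ≤ π) :
    volume ({θ | ¬(0 < cos θ ↔ 0 < cos (θ - α))} ∩ Ioo (-π) π) = ENNReal.ofReal (2 * α) := by
  have hp := pi_pos
  rw [← measure_sdiff_null (t := {α - π / 2, π / 2}) ((toFinite _).measure_zero _),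
    setOf_cos_pos_ne_inter_Ioo_sdiff h0 hπ,
    measure_union _ (measurableSet_Ioo.union measurableSet_Ioo), measure_union _ measurableSet_Ioo,
    volume_Ioo, volume_Ioo, volume_Ioo]
  · rcases le_total α (π / 2) with h | h
    · rw [min_eq_right (by linarith), ENNReal.ofReal_of_nonpos (by linarith), zero_add,
        ← ENNReal.ofReal_add (by linarith) (by linarith)]
      congr 1; ring
    · rw [min_eq_left (by linarith), ← ENNReal.ofReal_add (by linarith) (by linarith),
        ← ENNReal.ofReal_add (by linarith) (by linarith)]
      congr 1; ring
  · rw [Set.disjoint_left]; grind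
  · rw [Set.disjoint_left]; grind

lemma sgn_ne_sgn_iff {s t : ℝ} : sgn s ≠ sgn t ↔ ¬(0 < s ↔ 0 < t) := by
  unfold sgn
  split_ifs <;> simp [*] <;> norm_num

/-- **Sheppard's formula.** If `G, G'` are independent standard Gaussians and
`H = ρ·G + √(1-ρ²)·G'` (so that `(G, H)` are ρ-correlated standard Gaussians), then
`Pr[sgn(G) ≠ sgn(H)] = arccos(ρ)/π`. -/
theorem sheppard_formula {Ω : Type*} [MeasurableSpace Ω] (μ : Measure Ω)
    [IsProbabilityMeasure μ] (ρ : ℝ) (hρ : ρ ∈ Set.Icc (-1 : ℝ) 1)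
    (G G' : Ω → ℝ) (hGmeas : Measurable G) (hG'meas : Measurable G')
    (hindep : IndepFun G G' μ)
    (hG : Measure.map G μ = gaussianReal 0 1)
    (hG' : Measure.map G' μ = gaussianReal 0 1) :
    μ {ω | sgn (G ω) ≠ sgn (ρ * G ω + Real.sqrt (1 - ρ ^ 2) * G' ω)} =
      ENNReal.ofReal (Real.arccos ρ / Real.pi) := by
  simp only [sgn_ne_sgn_iff]
  have hS : MeasurableSet
      {p : ℝ × ℝ | ¬(0 < p.1 ↔ 0 < ρ * p.1 + Real.sqrt (1 - ρ ^ 2) * p.2)} :=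
    ((measurableSet_lt (by fun_prop) (by fun_prop)).iff
      (measurableSet_lt (by fun_prop) (by fun_prop))).compl
  have hA : MeasurableSet {θ | ¬(0 < Real.cos θ ↔ 0 < Real.cos (θ - Real.arccos ρ))} :=
    ((measurableSet_lt (by fun_prop) (by fun_prop)).iff
      (measurableSet_lt (by fun_prop) (by fun_prop))).compl
  have hmap := (indepFun_iff_map_prod_eq_prod_map_map hGmeas.aemeasurable
    hG'meas.aemeasurable).1 hindep
  rw [hG, hG'] at hmap
  calc
    _ = (gaussianReal 0 1).prod (gaussianReal 0 1)
        {p : ℝ × ℝ | ¬(0 < p.1 ↔ 0 < ρ * p.1 + Real.sqrt (1 - ρ ^ 2) * p.2)} := by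
      rw [← hmap, Measure.map_apply (hGmeas.prodMk hG'meas) hS]
      rfl
    _ = ENNReal.ofReal (2 * Real.arccos ρ) / ENNReal.ofReal (2 * Real.pi) := by
      rw [gaussianReal_prod_cone hS hA, volume_setOf_cos_pos_ne_inter_Ioo (Real.arccos_nonneg ρ)
        (Real.arccos_le_pi ρ)]
      intro r hr θ
      have hrot : ρ * (r * Real.cos θ) + Real.sqrt (1 - ρ ^ 2) * (r * Real.sin θ) =
          r * Real.cos (θ - Real.arccos ρ) := by
        rw [Real.cos_sub, Real.cos_arccos hρ.1 hρ.2, Real.sin_arccos]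
        ring
      simp only [Set.mem_ofPred_eq, hrot, mul_pos_iff_of_pos_left hr]
    _ = _ := by
      rw [← ENNReal.ofReal_div_of_pos Real.two_pi_pos, mul_div_mul_left _ _ two_ne_zero]
end

section
/- Level-1 inequality: there is a universal constant C > 0 such that for every n and every f : {-1,1}^n → {0,1} with α := E_x[f(x)] ∈ (0,1), the level-1 Fourier weight satisfies Σ_{i=1}^n f̂({i})^2 ≤ C · α^2 · ln(1/α). -/
open Finset

theorem expect_mono {n : ℕ} {g h : (Fin n → Bool) → ℝ} (hgh : ∀ x, g x ≤ h x) :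
    expect g ≤ expect h :=
  div_le_div_of_nonneg_right (Finset.sum_le_sum fun x _ => hgh x) (by positivity)

theorem expect_add {n : ℕ} (g h : (Fin n → Bool) → ℝ) :
    expect (fun x => g x + h x) = expect g + expect h := by
  simp only [_root_.expect, Finset.sum_add_distrib, add_div]

theorem expect_const_mul {n : ℕ} (c : ℝ) (g : (Fin n → Bool) → ℝ) :
    expect (fun x => c * g x) = c * expect g := by
  simp only [_root_.expect, ← Finset.mul_sum, mul_div_assoc]

theorem expect_sum {n : ℕ} {ι : Type*} (s : Finset ι) (g : ι → (Fin n → Bool) → ℝ) :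
    expect (fun x => ∑ i ∈ s, g i x) = ∑ i ∈ s, expect (g i) := by
  simp only [_root_.expect]
  rw [Finset.sum_comm, Finset.sum_div]

theorem fhat_singleton {n : ℕ} (f : (Fin n → Bool) → ℝ) (i : Fin n) :
    fhat f {i} = expect fun x => f x * bR (x i) := by
  simp [fhat, chi]

/-- The pairing of `f` with a linear form in the coordinates. -/
theorem expect_mul_linear {n : ℕ} (f : (Fin n → Bool) → ℝ) (c : Fin n → ℝ) :
    expect (fun x => f x * ∑ i, c i * bR (x i)) = ∑ i, c i * fhat f {i} := by
  simp only [fhat_singleton, ← expect_const_mul, ← expect_sum, Finset.mul_sum]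
  congr! 3
  ring

/-- Linear forms in uniform random signs are sub-Gaussian. -/
theorem expect_exp_linear_le {n : ℕ} (c : Fin n → ℝ) :
    expect (fun x => Real.exp (∑ i, c i * bR (x i))) ≤ Real.exp ((∑ i, c i ^ 2) / 2) := by
  have hprod : ∑ x : Fin n → Bool, Real.exp (∑ i, c i * bR (x i)) =
      ∏ i, (2 * Real.cosh (c i)) := by
    simp only [Real.exp_sum]
    rw [← Fintype.prod_sum fun i b => Real.exp (c i * bR b)]
    refine Finset.prod_congr rfl fun i _ => ?_
    rw [Real.cosh_eq]
    simp [bR]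
    ring
  rw [_root_.expect, hprod, Finset.prod_mul_distrib, Finset.prod_const, Finset.card_univ,
    Fintype.card_fin, mul_div_cancel_left₀ _ (by positivity), Finset.sum_div, Real.exp_sum]
  exact Finset.prod_le_prod (fun i _ => (Real.cosh_pos _).le)
    fun i _ => Real.cosh_le_exp_half_sq _

/-- Jensen's inequality for `exp` under the probability density `f / expect f`. -/
theorem expect_mul_exp_le {n : ℕ} {f : (Fin n → Bool) → ℝ} (hf : ∀ x, 0 ≤ f x)
    (hpos : 0 < expect f) (g : (Fin n → Bool) → ℝ) :
    expect f * Real.exp (expect (fun x => f x * g x) / expect f) ≤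
      expect fun x => f x * Real.exp (g x) := by
  set m := expect (fun x => f x * g x) / expect f with hm
  have hmean : expect (fun x => f x * g x) = m * expect f := by
    rw [hm, div_mul_cancel₀ _ hpos.ne']
  calc expect f * Real.exp m
      = expect fun x => Real.exp m * (1 - m) * f x + Real.exp m * (f x * g x) := by
        rw [expect_add, expect_const_mul, expect_const_mul, hmean]
        ring
    _ ≤ expect fun x => f x * Real.exp (g x) := by
        refine expect_mono fun x => ?_
        have htangent : Real.exp m * (g x - m + 1) ≤ Real.exp (g x) := by
          calc Real.exp m * (g x - m + 1) ≤ Real.exp m * Real.exp (g x - m) := by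
                gcongr
                exact Real.add_one_le_exp _
            _ = Real.exp (g x) := by rw [← Real.exp_add, add_sub_cancel]
        linarith [mul_le_mul_of_nonneg_left htangent (hf x)]

/-- **Level-1 inequality.** There is a universal constant `C > 0` such that every
`f : {-1,1}ⁿ → {0,1}` with mean `α ∈ (0,1)` has level-1 Fourier weight at most
`C · α² · ln(1/α)`. -/
theorem level_one_inequality :
    ∃ C : ℝ, 0 < C ∧
      ∀ (n : ℕ) (f : (Fin n → Bool) → ℝ),
        (∀ x, f x = 0 ∨ f x = 1) →
        0 < expect f → expect f < 1 →
        ∑ i, fhat f {i} ^ 2 ≤ C * (expect f) ^ 2 * Real.log (1 / expect f) := by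
  refine ⟨2, two_pos, fun n f hf hpos _ => ?_⟩
  have hnonneg : ∀ x, 0 ≤ f x := fun x => by rcases hf x with h | h <;> simp [h]
  have hle_one : ∀ x, f x ≤ 1 := fun x => by rcases hf x with h | h <;> simp [h]
  set α := expect f with hα
  set W := ∑ i, fhat f {i} ^ 2 with hW
  have hpair : expect (fun x => f x * ∑ i, fhat f {i} / α * bR (x i)) = W / α := by
    rw [expect_mul_linear, hW, Finset.sum_div]
    exact Finset.sum_congr rfl fun i _ => by ring
  have hsq : ∑ i, (fhat f {i} / α) ^ 2 = W / α ^ 2 := by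
    simp only [div_pow, hW, Finset.sum_div]
  have hexp : α * Real.exp (W / α ^ 2) ≤ Real.exp (W / α ^ 2 / 2) := by
    calc α * Real.exp (W / α ^ 2)
        = α * Real.exp (expect (fun x => f x * ∑ i, fhat f {i} / α * bR (x i)) / α) := by
          rw [hpair, div_div, sq]
      _ ≤ expect fun x => f x * Real.exp (∑ i, fhat f {i} / α * bR (x i)) :=
          expect_mul_exp_le hnonneg hpos _
      _ ≤ expect fun x => Real.exp (∑ i, fhat f {i} / α * bR (x i)) :=
          expect_mono fun x => mul_le_of_le_one_left (Real.exp_pos _).le (hle_one x)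
      _ ≤ Real.exp (W / α ^ 2 / 2) := by
          rw [← hsq]
          exact expect_exp_linear_le _
  have hlog := Real.log_le_log (by positivity) hexp
  rw [Real.log_mul hpos.ne' (Real.exp_pos _).ne', Real.log_exp, Real.log_exp] at hlog
  have hbound : W / α ^ 2 ≤ 2 * Real.log (1 / α) := by
    rw [one_div, Real.log_inv]
    linarith
  rw [div_le_iff₀ (by positivity)] at hbound
  linarith
end

section
/- Small set expansion at ρ = 1/3: let A ⊆ {-1,1}^n with density α := |A|·2^{−n}, and let 1_A : {-1,1}^n → {0,1} be its indicator function. Then Stab_{1/3}(1_A) = Σ_{S ⊆ [n]} (1/3)^{|S|} · (1̂_A(S))^2 ≤ α^{3/2}. Equivalently, if x is uniform on A and y ~ N_{1/3}(x), then Pr[y ∈ A] ≤ α^{1/2}. -/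
open Finset

/-- The transition weight of the noise distribution `N_ρ(x)`: the probability that
`y ~ N_ρ(x)` equals a given `y`. -/
noncomputable def noiseWeight {n : ℕ} (ρ : ℝ) (x y : Fin n → Bool) : ℝ :=
  ∏ i, if y i = x i then (1 + ρ) / 2 else (1 - ρ) / 2

lemma bR_sq (b : Bool) : bR b ^ 2 = 1 := by
  cases b <;> simp [bR]

lemma bR_not (b : Bool) : bR (!b) = -bR b := by
  cases b <;> simp [bR]

lemma chi_insert {n : ℕ} {a : Fin n} {S : Finset (Fin n)} (ha : a ∉ S) (x : Fin n → Bool) :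
    chi (insert a S) x = bR (x a) * chi S x := by
  simp [chi, prod_insert ha]

lemma chi_update {n : ℕ} {a : Fin n} {S : Finset (Fin n)} (ha : a ∉ S) (x : Fin n → Bool)
    (b : Bool) : chi S (Function.update x a b) = chi S x := by
  refine prod_congr rfl fun i hi => ?_
  rw [Function.update_of_ne (ne_of_mem_of_not_mem hi ha)]

/-- A coordinate is orthogonal to every function that does not depend on it. -/
lemma sum_bR_mul_eq_zero {n : ℕ} (a : Fin n) (g : (Fin n → Bool) → ℝ)
    (hg : ∀ x b, g (Function.update x a b) = g x) :
    ∑ x : Fin n → Bool, bR (x a) * g x = 0 := by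
  have hinv : Function.Involutive
      (fun x : Fin n → Bool => Function.update x a (!(x a))) := by
    intro x
    simp
  have h := Equiv.sum_comp hinv.toPerm (fun x => bR (x a) * g x)
  simp only [Function.Involutive.coe_toPerm, Function.update_self, hg, bR_not, neg_mul,
    sum_neg_distrib] at h
  linarith

/-- The `(2,4)`-hypercontractive inequality for multilinear polynomials. -/
lemma sum_pow_four_le {n : ℕ} (V : Finset (Fin n)) (d : Finset (Fin n) → ℝ) :
    ∑ x : Fin n → Bool, (∑ S ∈ V.powerset, d S * chi S x) ^ 4 ≤
      2 ^ n * (∑ S ∈ V.powerset, 3 ^ S.card * d S ^ 2) ^ 2 := by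
  induction V using Finset.induction_on generalizing d with
  | empty =>
    simp only [powerset_empty, sum_singleton, card_empty, pow_zero, one_mul]
    simp only [chi, prod_empty, mul_one, sum_const, card_univ, Fintype.card_fun,
      Fintype.card_bool, Fintype.card_fin, nsmul_eq_mul]
    push_cast
    exact le_of_eq (by ring)
  | insert a V ha ih =>
    have hmem : ∀ S ∈ V.powerset, a ∉ S := fun S hS h => ha (mem_powerset.1 hS h)
    set P : (Fin n → Bool) → ℝ := fun x => ∑ S ∈ V.powerset, d S * chi S x with hP
    set Q : (Fin n → Bool) → ℝ :=
      fun x => ∑ S ∈ V.powerset, d (insert a S) * chi S x with hQ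
    set p : ℝ := ∑ S ∈ V.powerset, 3 ^ S.card * d S ^ 2 with hp
    set q : ℝ := ∑ S ∈ V.powerset, 3 ^ S.card * d (insert a S) ^ 2 with hq
    have hp0 : 0 ≤ p := sum_nonneg fun S _ => by positivity
    have hq0 : 0 ≤ q := sum_nonneg fun S _ => by positivity
    have hPu : ∀ x b, P (Function.update x a b) = P x := fun x b =>
      sum_congr rfl fun S hS => by rw [chi_update (hmem S hS)]
    have hQu : ∀ x b, Q (Function.update x a b) = Q x := fun x b =>
      sum_congr rfl fun S hS => by rw [chi_update (hmem S hS)]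
    have hPQ : ∀ x, ∑ S ∈ (insert a V).powerset, d S * chi S x = P x + bR (x a) * Q x := by
      intro x
      rw [sum_powerset_insert ha, hP, hQ, mul_sum]
      congr 1
      refine sum_congr rfl fun S hS => ?_
      rw [chi_insert (hmem S hS)]
      ring
    have hpq : ∑ S ∈ (insert a V).powerset, 3 ^ S.card * d S ^ 2 = p + 3 * q := by
      rw [sum_powerset_insert ha, hp, hq, mul_sum]
      congr 1
      refine sum_congr rfl fun S hS => ?_
      rw [card_insert_of_notMem (hmem S hS)]
      ring
    have hodd := sum_bR_mul_eq_zero a (fun x => 4 * P x ^ 3 * Q x + 4 * P x * Q x ^ 3)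
      fun x b => by rw [hPu, hQu]
    have hexp : ∑ x, (P x + bR (x a) * Q x) ^ 4 =
        ∑ x, P x ^ 4 + 6 * ∑ x, P x ^ 2 * Q x ^ 2 + ∑ x, Q x ^ 4 := by
      rw [← add_zero (∑ x, P x ^ 4 + _ + _), ← hodd, mul_sum, ← sum_add_distrib,
        ← sum_add_distrib, ← sum_add_distrib]
      refine sum_congr rfl fun x _ => ?_
      linear_combination (6 * P x ^ 2 * Q x ^ 2 + 4 * P x * Q x ^ 3 * bR (x a) +
        Q x ^ 4 * (bR (x a) ^ 2 + 1)) * bR_sq (x a)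
    have h1 : ∑ x, P x ^ 4 ≤ 2 ^ n * p ^ 2 := ih d
    have h2 : ∑ x, Q x ^ 4 ≤ 2 ^ n * q ^ 2 := ih fun S => d (insert a S)
    have h3 : ∑ x, P x ^ 2 * Q x ^ 2 ≤ 2 ^ n * (p * q) := by
      have hcs := sum_mul_sq_le_sq_mul_sq univ (fun x => P x ^ 2) (fun x => Q x ^ 2)
      simp only [← pow_mul, Nat.reduceMul] at hcs
      refine le_of_abs_le (abs_le_of_sq_le_sq ?_ (by positivity))
      calc _ ≤ _ := hcs
        _ ≤ (2 ^ n * p ^ 2) * (2 ^ n * q ^ 2) := by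
            refine mul_le_mul h1 h2 ?_ (by positivity)
            exact sum_nonneg fun x _ => by positivity
        _ = _ := by ring
    simp only [hPQ, hpq]
    rw [hexp]
    have h4 : 0 ≤ (2 : ℝ) ^ n * q ^ 2 := by positivity
    linarith

lemma sum_pow_four_le_card {ι : Type*} (A : Finset ι) (h : ι → ℝ) :
    (∑ x ∈ A, h x) ^ 4 ≤ (A.card : ℝ) ^ 3 * ∑ x ∈ A, h x ^ 4 := by
  have h1 : (∑ x ∈ A, h x) ^ 2 ≤ A.card * ∑ x ∈ A, h x ^ 2 := sq_sum_le_card_mul_sum_sq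
  have h2 : (∑ x ∈ A, h x ^ 2) ^ 2 ≤ A.card * ∑ x ∈ A, (h x ^ 2) ^ 2 :=
    sq_sum_le_card_mul_sum_sq
  simp only [← pow_mul, Nat.reduceMul] at h2
  calc (∑ x ∈ A, h x) ^ 4 = ((∑ x ∈ A, h x) ^ 2) ^ 2 := by ring
    _ ≤ (A.card * ∑ x ∈ A, h x ^ 2) ^ 2 := by gcongr
    _ = (A.card : ℝ) ^ 2 * (∑ x ∈ A, h x ^ 2) ^ 2 := by ring
    _ ≤ (A.card : ℝ) ^ 2 * (A.card * ∑ x ∈ A, h x ^ 4) := by gcongr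
    _ = _ := by ring

lemma noiseWeight_eq_sum {n : ℕ} (ρ : ℝ) (x y : Fin n → Bool) :
    noiseWeight ρ x y = (∑ S : Finset (Fin n), ρ ^ S.card * (chi S x * chi S y)) / 2 ^ n := by
  have h : ∀ i, (if y i = x i then (1 + ρ) / 2 else (1 - ρ) / 2) =
      (1 + ρ * (bR (x i) * bR (y i))) / 2 := by
    intro i
    cases x i <;> cases y i <;> simp [bR] <;> ring
  simp only [noiseWeight, h, prod_div_distrib, prod_one_add, prod_const, card_univ,
    Fintype.card_fin, powerset_univ, prod_mul_distrib, chi]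

lemma fhat_indicator {n : ℕ} (A : Finset (Fin n → Bool)) (S : Finset (Fin n)) :
    fhat (fun x => if x ∈ A then 1 else 0) S = (∑ x ∈ A, chi S x) / 2 ^ n := by
  simp [fhat, _root_.expect, ite_mul]

/-- The noise stability of an indicator as a sum of noise weights. -/
lemma sum_noiseWeight_eq {n : ℕ} (ρ : ℝ) (A : Finset (Fin n → Bool)) :
    ∑ x ∈ A, ∑ y : Fin n → Bool, noiseWeight ρ x y * (if y ∈ A then 1 else 0) =
      2 ^ n * ∑ S : Finset (Fin n),
        ρ ^ S.card * fhat (fun x => if x ∈ A then 1 else 0) S ^ 2 := by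
  have h : ∀ S : Finset (Fin n), 2 ^ n * (ρ ^ S.card * ((∑ x ∈ A, chi S x) / 2 ^ n) ^ 2) =
      ∑ x ∈ A, ∑ y ∈ A, ρ ^ S.card * (chi S x * chi S y) / 2 ^ n := by
    intro S
    simp only [← sum_div, ← mul_sum, ← sum_mul]
    field_simp
  simp only [mul_ite, mul_one, mul_zero, sum_ite_mem, univ_inter, fhat_indicator,
    noiseWeight_eq_sum]
  rw [mul_sum]
  simp only [h]
  refine Eq.trans ?_ sum_comm
  refine sum_congr rfl fun x _ => ?_
  simp only [sum_div]
  exact sum_comm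

/-- The squared noise stability of an indicator at rate `1/3` is at most the cubed density. -/
lemma stability_sq_le {n : ℕ} (A : Finset (Fin n → Bool)) :
    (∑ S : Finset (Fin n),
      (1 / 3 : ℝ) ^ S.card * fhat (fun x => if x ∈ A then 1 else 0) S ^ 2) ^ 2 ≤
      ((A.card : ℝ) / 2 ^ n) ^ 3 := by
  set c : Finset (Fin n) → ℝ := fhat (fun x => if x ∈ A then 1 else 0) with hc
  set s : ℝ := ∑ S : Finset (Fin n), (1 / 3 : ℝ) ^ S.card * c S ^ 2 with hs
  set h : (Fin n → Bool) → ℝ :=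
    fun x => ∑ S : Finset (Fin n), (1 / 3 : ℝ) ^ S.card * c S * chi S x with hh
  have hN : (0 : ℝ) < 2 ^ n := by positivity
  have hsum : ∑ x ∈ A, h x = 2 ^ n * s := by
    rw [hh, sum_comm, hs, mul_sum]
    refine sum_congr rfl fun S _ => ?_
    rw [← mul_sum]
    have : ∑ x ∈ A, chi S x = 2 ^ n * c S := by
      rw [hc, fhat_indicator]
      field_simp
    rw [this]
    ring
  have hhyp : ∑ x, h x ^ 4 ≤ 2 ^ n * s ^ 2 := by
    have := sum_pow_four_le univ fun S : Finset (Fin n) => (1 / 3 : ℝ) ^ S.card * c S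
    simp only [powerset_univ] at this
    refine this.trans_eq ?_
    congr 2
    refine sum_congr rfl fun S _ => ?_
    have h3 : (3 : ℝ) ^ S.card * (1 / 3) ^ S.card = 1 := by
      rw [← mul_pow]
      norm_num
    linear_combination (1 / 3 : ℝ) ^ S.card * c S ^ 2 * h3
  have hA : ∑ x ∈ A, h x ^ 4 ≤ ∑ x, h x ^ 4 :=
    sum_le_sum_of_subset_of_nonneg (subset_univ A) fun x _ _ => by positivity
  have hmain : (2 ^ n * s) ^ 4 ≤ (A.card : ℝ) ^ 3 * (2 ^ n * s ^ 2) := by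
    rw [← hsum]
    refine (sum_pow_four_le_card A h).trans ?_
    gcongr
    exact hA.trans hhyp
  rcases eq_or_ne s 0 with h0 | h0
  · rw [h0, zero_pow two_ne_zero]
    positivity
  · have hpos : 0 < (2 : ℝ) ^ n * s ^ 2 := by positivity
    rw [div_pow, le_div_iff₀ (by positivity)]
    refine le_of_mul_le_mul_right ?_ hpos
    calc _ = (2 ^ n * s) ^ 4 := by ring
      _ ≤ _ := hmain

/-- **Small set expansion at `ρ = 1/3`.** For `A ⊆ {-1,1}ⁿ` of density `α`, with
indicator `1_A`, one has `Stab_{1/3}(1_A) = ∑_S (1/3)^{|S|} 1̂_A(S)² ≤ α^{3/2}`;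
equivalently, for `x` uniform on `A` and `y ~ N_{1/3}(x)`, `Pr[y ∈ A] ≤ α^{1/2}`. -/
theorem small_set_expansion (n : ℕ) (A : Finset (Fin n → Bool)) :
    let α : ℝ := A.card / 2 ^ n
    let f : (Fin n → Bool) → ℝ := fun x => if x ∈ A then 1 else 0
    (∑ S : Finset (Fin n), (1 / 3 : ℝ) ^ S.card * fhat f S ^ 2 ≤ α ^ (3 / 2 : ℝ)) ∧
    (A.Nonempty →
      (∑ x ∈ A, ∑ y : Fin n → Bool, noiseWeight (1 / 3) x y * (if y ∈ A then 1 else 0)) /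
          A.card ≤ α ^ (1 / 2 : ℝ)) := by
  intro α f
  have hα : 0 ≤ α := by positivity
  have hstab : ∑ S : Finset (Fin n), (1 / 3 : ℝ) ^ S.card * fhat f S ^ 2 ≤
      α ^ (3 / 2 : ℝ) := by
    refine le_of_abs_le (abs_le_of_sq_le_sq ((stability_sq_le A).trans_eq ?_) (by positivity))
    rw [← Real.rpow_natCast (α ^ (3 / 2 : ℝ)), ← Real.rpow_mul hα, ← Real.rpow_natCast]
    norm_num [α]
  refine ⟨hstab, fun hA => ?_⟩
  have hcard : (0 : ℝ) < A.card := by exact_mod_cast hA.card_pos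
  have hα' : 0 < α := by positivity
  rw [sum_noiseWeight_eq, div_le_iff₀ hcard]
  calc _ ≤ 2 ^ n * α ^ (3 / 2 : ℝ) := by gcongr
    _ = 2 ^ n * (α ^ (1 / 2 : ℝ) * α) := by
        rw [← Real.rpow_add_one hα'.ne']
        norm_num
    _ = α ^ (1 / 2 : ℝ) * (2 ^ n * α) := by ring
    _ = α ^ (1 / 2 : ℝ) * A.card := by
        congr 1
        exact mul_div_cancel₀ _ (by positivity)
end

section
/- Kindler–O'Donnell theorem (special case of Borell's isoperimetric inequality): let f : ℝ^n → {-1,1} be measurable with E[f(G)] = 0 for G a standard n-dimensional Gaussian vector. Let ℓ ≥ 2 be an integer and δ = π/(2ℓ). Then RS_f(δ) := Pr[f(G) ≠ f(H)] ≥ 1/(2ℓ), where (G, H) are cos(δ)-correlated n-dimensional Gaussians. -/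
open MeasureTheory ProbabilityTheory

/-- The standard Gaussian measure on `ℝⁿ` (product of standard one-dimensional
Gaussians). -/
noncomputable def gaussianPi (n : ℕ) : Measure (Fin n → ℝ) :=
  Measure.pi fun _ : Fin n => gaussianReal 0 1

instance (n : ℕ) : IsGaussian (gaussianPi n) := by
  rw [← isGaussian_map_equiv_iff (EuclideanSpace.equiv (Fin n) ℝ).symm]
  have h : (gaussianPi n).map (EuclideanSpace.equiv (Fin n) ℝ).symm =
      stdGaussian (EuclideanSpace ℝ (Fin n)) := map_pi_eq_stdGaussian
  rw [h]
  infer_instance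

/-- A product of two standard Gaussian measures is invariant under rotations. -/
lemma measurePreserving_rotation_gaussianPi (n : ℕ) (θ : ℝ) :
    MeasurePreserving (ContinuousLinearMap.rotation (E := Fin n → ℝ) θ)
      ((gaussianPi n).prod (gaussianPi n)) ((gaussianPi n).prod (gaussianPi n)) := by
  refine ⟨by fun_prop, IsGaussian.map_rotation_eq_self_of_forall_strongDual_eq_zero
    (fun L => ?_) θ⟩
  rw [L.integral_comp_id_comm IsGaussian.integrable_id]
  have h : ∫ x, x ∂(gaussianPi n) = 0 := by
    ext i
    have hint (i : Fin n) : Integrable (fun x : Fin n → ℝ => x i) (gaussianPi n) :=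
      integrable_eval IsGaussian.integrable_id
    rw [eval_integral (f := fun x : Fin n → ℝ => x) hint, gaussianPi, integral_eval]
    simp
  simp [h]

/-- A balanced `±1`-valued function takes different values at two independent points with
probability `1 / 2`. -/
lemma measureReal_prod_ne_of_integral_eq_zero {α : Type*} [MeasurableSpace α] {μ : Measure α}
    [IsProbabilityMeasure μ] {f : α → ℝ} (hmeas : Measurable f)
    (hval : ∀ x, f x = 1 ∨ f x = -1) (hmean : ∫ x, f x ∂μ = 0) :
    (μ.prod μ).real {p | f p.1 ≠ f p.2} = 1 / 2 := by
  have hS : MeasurableSet {p : α × α | f p.1 ≠ f p.2} :=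
    (measurableSet_eq_fun (by fun_prop) (by fun_prop)).compl
  have hprod : ∫ p, f p.1 * f p.2 ∂(μ.prod μ) = 0 := by
    rw [integral_prod_mul, hmean, zero_mul]
  have hfun : (fun p : α × α => f p.1 * f p.2) =
      fun p => 1 - 2 * {p : α × α | f p.1 ≠ f p.2}.indicator (fun _ => (1 : ℝ)) p := by
    ext p
    rcases hval p.1 with h1 | h1 <;> rcases hval p.2 with h2 | h2 <;>
      norm_num [Set.indicator, h1, h2]
  rw [hfun, integral_sub (integrable_const _)
    (((integrable_const _).indicator hS).const_mul _), integral_const_mul,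
    integral_indicator_const _ hS] at hprod
  simp only [integral_const, probReal_univ, smul_eq_mul, mul_one] at hprod
  linarith

/-- Union bound: if a sequence of functions changes value from step `0` to step `m`, it changes
value at some intermediate step. -/
lemma measureReal_ne_le_sum_range {α β : Type*} [MeasurableSpace α] {μ : Measure α}
    [IsFiniteMeasure μ] (g : ℕ → α → β) (m : ℕ) :
    μ.real {x | g 0 x ≠ g m x} ≤ ∑ j ∈ Finset.range m, μ.real {x | g j x ≠ g (j + 1) x} := by
  induction m with
  | zero => simp
  | succ m ih =>
    rw [Finset.sum_range_succ]
    have hsub : {x | g 0 x ≠ g (m + 1) x} ⊆ {x | g 0 x ≠ g m x} ∪ {x | g m x ≠ g (m + 1) x} := by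
      intro x hx
      by_contra! h
      simp only [Set.mem_union, Set.mem_ofPred_eq, not_or, not_not] at h
      exact hx (h.1.trans h.2)
    calc _ ≤ _ := measureReal_mono hsub
      _ ≤ _ := measureReal_union_le _ _
      _ ≤ _ := by gcongr

/-- **Kindler–O'Donnell theorem** (special case of Borell's isoperimetric inequality).
Let `f : ℝⁿ → {-1,1}` be measurable with `E[f(G)] = 0` under the standard Gaussian, let
`ℓ ≥ 2` and `δ = π/(2ℓ)`. If `(G, H)` are `cos δ`-correlated standard `n`-dimensional
Gaussians (i.e. `H = cos δ · G + sin δ · G'` with `G, G'` independent standard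
Gaussians), then the rotation sensitivity satisfies `RS_f(δ) = Pr[f(G) ≠ f(H)] ≥ 1/(2ℓ)`. -/
theorem kindler_odonnell_borell (n : ℕ) (f : (Fin n → ℝ) → ℝ)
    (hmeas : Measurable f) (hval : ∀ x, f x = 1 ∨ f x = -1)
    (hmean : ∫ x, f x ∂(gaussianPi n) = 0)
    (ℓ : ℕ) (hℓ : 2 ≤ ℓ) :
    ENNReal.ofReal (1 / (2 * ℓ) : ℝ) ≤
      ((gaussianPi n).prod (gaussianPi n))
        {p | f p.1 ≠
          f (fun i => Real.cos (Real.pi / (2 * ℓ)) * p.1 i +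
                Real.sin (Real.pi / (2 * ℓ)) * p.2 i)} := by
  set δ : ℝ := Real.pi / (2 * ℓ) with hδ
  set P := (gaussianPi n).prod (gaussianPi n) with hP
  let g : ℕ → (Fin n → ℝ) × (Fin n → ℝ) → ℝ :=
    fun j p => f (Real.cos (j * δ) • p.1 + Real.sin (j * δ) • p.2)
  have hgm (j : ℕ) : Measurable (g j) := hmeas.comp (by fun_prop)
  have hℓ0 : (ℓ : ℝ) ≠ 0 := by positivity
  have hrot (j : ℕ) (p : (Fin n → ℝ) × (Fin n → ℝ)) (k : ℕ) :
      g k (ContinuousLinearMap.rotation (j * δ) p) = g (j + k) p := by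
    simp only [g, ContinuousLinearMap.rotation_apply]
    congr 1
    push_cast
    rw [add_mul, Real.cos_add, Real.sin_add]
    module
  have hstep (j : ℕ) : P.real {p | g j p ≠ g (j + 1) p} = P.real {p | g 0 p ≠ g 1 p} := by
    have hS : MeasurableSet {p | g 0 p ≠ g 1 p} := (measurableSet_eq_fun (hgm 0) (hgm 1)).compl
    rw [← (measurePreserving_rotation_gaussianPi n (j * δ)).measureReal_preimage
      hS.nullMeasurableSet]
    simp only [Set.preimage_ofPred_eq, hrot, add_zero, P]
  have hunion := measureReal_ne_le_sum_range (μ := P) g ℓ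
  have hend : {p | g 0 p ≠ g ℓ p} = {p | f p.1 ≠ f p.2} := by
    have : ℓ * δ = Real.pi / 2 := by rw [hδ]; field_simp
    simp [g, this]
  rw [hend, measureReal_prod_ne_of_integral_eq_zero hmeas hval hmean,
    Finset.sum_congr rfl fun j _ => hstep j, Finset.sum_const, Finset.card_range,
    nsmul_eq_mul] at hunion
  have hset : {p : (Fin n → ℝ) × (Fin n → ℝ) | f p.1 ≠
      f (fun i => Real.cos δ * p.1 i + Real.sin δ * p.2 i)} = {p | g 0 p ≠ g 1 p} := by
    simp only [g, Nat.cast_zero, zero_mul, Real.cos_zero, Real.sin_zero, one_smul, zero_smul,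
      add_zero, Nat.cast_one, one_mul]
    rfl
  rw [hset, ENNReal.ofReal_le_iff_le_toReal (measure_ne_top _ _)]
  change _ ≤ P.real _
  rw [div_le_iff₀ (by positivity)]
  linarith
end

section
/- Hybrid argument for low-degree polynomials (from the invariance principle): let d ≥ 1 and let Q(u_1,…,u_n) = Σ_{S ⊆ [n], |S| ≤ d} c_S ∏_{i∈S} u_i be a multilinear polynomial with Σ_{S ≠ ∅} c_S^2 = 1; set τ := max_{i∈[n]} Σ_{S ∋ i} c_S^2. Let ψ : ℝ → ℝ be four-times continuously differentiable with |ψ⁽⁴⁾(x)| ≤ C for all x ∈ ℝ. Let X_1,…,X_n be independent uniform ±1 random variables and G_1,…,G_n independent standard Gaussians. Then |E[ψ(Q(X_1,…,X_n))] − E[ψ(Q(G_1,…,G_n))]| ≤ d · 9^d · C · τ. -/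
open Finset

open MeasureTheory ProbabilityTheory

/-- A measure on `ℝ` with finite fourth moment whose first three moments are those of a standard
Gaussian, and whose fourth moment is at most that of a standard Gaussian. -/
structure MatchesGaussianMoments (ν : Measure ℝ) : Prop where
  memLp : MemLp (fun x : ℝ => x) 4 ν
  moment_one : ∫ x, x ∂ν = 0
  moment_two : ∫ x, x ^ 2 ∂ν = 1
  moment_three : ∫ x, x ^ 3 ∂ν = 0
  moment_four : ∫ x, x ^ 4 ∂ν ≤ 3

section Integrability

variable {Ω : Type*} [MeasurableSpace Ω] {μ : Measure Ω}

theorem integrable_mul_mul_mul_of_memLp_four {a b c d : Ω → ℝ} (ha : MemLp a 4 μ)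
    (hb : MemLp b 4 μ) (hc : MemLp c 4 μ) (hd : MemLp d 4 μ) :
    Integrable (fun x => a x * b x * c x * d x) μ := by
  have key : ∀ {f : Ω → ℝ}, MemLp f 4 μ → Integrable (fun x => f x ^ 4) μ := by
    intro f hf
    have h := MemLp.integrable_norm_pow (p := 4) (by exact_mod_cast hf) (by norm_num)
    refine h.congr (Filter.Eventually.of_forall fun x => ?_)
    simp only [Real.norm_eq_abs]
    exact Even.pow_abs ⟨2, rfl⟩ _
  refine (((key ha).add (key hb)).add ((key hc).add (key hd))).mono'
    (((ha.1.mul hb.1).mul hc.1).mul hd.1) (Filter.Eventually.of_forall fun x => ?_)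
  simp only [Pi.add_apply, Real.norm_eq_abs]
  rw [abs_le]
  constructor <;>
  nlinarith [sq_nonneg (a x * b x + c x * d x), sq_nonneg (a x * b x - c x * d x),
    sq_nonneg (a x ^ 2 - b x ^ 2), sq_nonneg (c x ^ 2 - d x ^ 2), sq_nonneg (a x ^ 2),
    sq_nonneg (b x ^ 2), sq_nonneg (c x ^ 2), sq_nonneg (d x ^ 2)]

theorem integrable_pow_of_memLp_four [IsFiniteMeasure μ] {f : Ω → ℝ} (hf : MemLp f 4 μ) {k : ℕ}
    (hk : k ≤ 4) : Integrable (fun x => f x ^ k) μ := by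
  have h1 : MemLp (fun _ : Ω => (1 : ℝ)) 4 μ := memLp_const 1
  interval_cases k
  · simp
  · simpa using integrable_mul_mul_mul_of_memLp_four hf h1 h1 h1
  · simpa [pow_succ] using integrable_mul_mul_mul_of_memLp_four hf hf h1 h1
  · simpa [pow_succ] using integrable_mul_mul_mul_of_memLp_four hf hf hf h1
  · simpa [pow_succ] using integrable_mul_mul_mul_of_memLp_four hf hf hf hf

end Integrability

section Taylor

variable {ψ : ℝ → ℝ} {C : ℝ}

theorem abs_sub_cubic_taylor_le (hψ : ContDiff ℝ 4 ψ) (hC : ∀ x, |iteratedDeriv 4 ψ x| ≤ C)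
    (a y : ℝ) :
    |ψ (a + y) - (ψ a + iteratedDeriv 1 ψ a * y + iteratedDeriv 2 ψ a / 2 * y ^ 2 +
      iteratedDeriv 3 ψ a / 6 * y ^ 3)| ≤ C / 24 * y ^ 4 := by
  rcases eq_or_ne y 0 with rfl | hy
  · simp
  have hne : a ≠ a + y := by simpa [eq_comm] using hy
  obtain ⟨z, -, hz⟩ := taylor_mean_remainder_lagrange_iteratedDeriv (n := 3) (f := ψ) hne
    (by exact_mod_cast hψ.contDiffOn)
  have hk : ∀ k : ℕ, k ≤ 4 →
      iteratedDerivWithin k ψ (Set.uIcc a (a + y)) a = iteratedDeriv k ψ a := by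
    intro k hk
    exact iteratedDerivWithin_eq_iteratedDeriv (uniqueDiffOn_uIcc hne)
      ((hψ.of_le (by exact_mod_cast hk)).contDiffAt) Set.left_mem_uIcc
  rw [taylor_within_apply] at hz
  simp only [Finset.sum_range_succ, Finset.sum_range_zero, smul_eq_mul, add_sub_cancel_left,
    hk 0 (by norm_num), hk 1 (by norm_num), hk 2 (by norm_num), hk 3 (by norm_num),
    iteratedDeriv_zero] at hz
  norm_num [Nat.factorial] at hz
  have : ψ (a + y) - (ψ a + iteratedDeriv 1 ψ a * y + iteratedDeriv 2 ψ a / 2 * y ^ 2 +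
      iteratedDeriv 3 ψ a / 6 * y ^ 3) = iteratedDeriv 4 ψ z / 24 * y ^ 4 := by
    simp only [iteratedDeriv_one]
    linarith
  rw [this, abs_mul, abs_div, abs_of_nonneg (by positivity : (0 : ℝ) ≤ y ^ 4)]
  have := hC z
  norm_num
  gcongr

theorem integrable_comp_of_memLp_four (hψ : ContDiff ℝ 4 ψ)
    (hC : ∀ x, |iteratedDeriv 4 ψ x| ≤ C) {Ω : Type*} [MeasurableSpace Ω] {μ : Measure Ω}
    [IsFiniteMeasure μ] {f : Ω → ℝ} (hf : MemLp f 4 μ) : Integrable (fun x => ψ (f x)) μ := by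
  have hpow := fun k (hk : k ≤ 4) => integrable_pow_of_memLp_four hf hk
  have hpoly : Integrable (fun x => ψ 0 + iteratedDeriv 1 ψ 0 * f x +
      iteratedDeriv 2 ψ 0 / 2 * f x ^ 2 + iteratedDeriv 3 ψ 0 / 6 * f x ^ 3) μ := by
    have h1 := hpow 1 (by norm_num)
    simp only [pow_one] at h1
    exact (((integrable_const _).add (h1.const_mul _)).add
      ((hpow 2 (by norm_num)).const_mul _)).add ((hpow 3 (by norm_num)).const_mul _)
  have hrem := ((hpow 4 le_rfl).const_mul (C / 24)).mono'
    ((hψ.continuous.comp_aestronglyMeasurable hf.1).sub hpoly.1)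
    (Filter.Eventually.of_forall fun x => by
      simpa using abs_sub_cubic_taylor_le hψ hC 0 (f x))
  refine (hrem.add hpoly).congr (Filter.Eventually.of_forall fun x => ?_)
  simp

theorem abs_integral_comp_sub_quadratic_le (hψ : ContDiff ℝ 4 ψ)
    (hC : ∀ x, |iteratedDeriv 4 ψ x| ≤ C) {ν : Measure ℝ} [IsProbabilityMeasure ν]
    (hν : MatchesGaussianMoments ν) (a b : ℝ) :
    |∫ x, ψ (a + x * b) ∂ν - (ψ a + iteratedDeriv 2 ψ a / 2 * b ^ 2)| ≤ C / 8 * b ^ 4 := by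
  have hC0 : 0 ≤ C := (abs_nonneg _).trans (hC 0)
  have hpow := fun k (hk : k ≤ 4) => integrable_pow_of_memLp_four hν.memLp hk
  have h1 : Integrable (fun x : ℝ => iteratedDeriv 1 ψ a * b * x) ν := by
    simpa using (hpow 1 (by norm_num)).const_mul (iteratedDeriv 1 ψ a * b)
  have h2 := (hpow 2 (by norm_num)).const_mul (iteratedDeriv 2 ψ a / 2 * b ^ 2)
  have h3 := (hpow 3 (by norm_num)).const_mul (iteratedDeriv 3 ψ a / 6 * b ^ 3)
  have h0 : Integrable (fun _ : ℝ => ψ a) ν := integrable_const _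
  have hint : Integrable (fun x => ψ (a + x * b)) ν :=
    integrable_comp_of_memLp_four hψ hC (f := fun x => a + x * b)
      ((memLp_const a).add (hν.memLp.mul_const b))
  have h01 : Integrable (fun x => ψ a + iteratedDeriv 1 ψ a * b * x) ν := h0.add h1
  have h012 : Integrable (fun x => ψ a + iteratedDeriv 1 ψ a * b * x +
      iteratedDeriv 2 ψ a / 2 * b ^ 2 * x ^ 2) ν := h01.add h2
  have hcubic : Integrable (fun x => ψ a + iteratedDeriv 1 ψ a * b * x +
      iteratedDeriv 2 ψ a / 2 * b ^ 2 * x ^ 2 + iteratedDeriv 3 ψ a / 6 * b ^ 3 * x ^ 3) ν :=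
    h012.add h3
  have hpoly : ∫ x, (ψ a + iteratedDeriv 1 ψ a * b * x + iteratedDeriv 2 ψ a / 2 * b ^ 2 * x ^ 2 +
      iteratedDeriv 3 ψ a / 6 * b ^ 3 * x ^ 3) ∂ν = ψ a + iteratedDeriv 2 ψ a / 2 * b ^ 2 := by
    rw [integral_add h012 h3, integral_add h01 h2, integral_add h0 h1,
      integral_const_mul, integral_const_mul, integral_const_mul, hν.moment_one, hν.moment_two,
      hν.moment_three]
    simp
  rw [← hpoly, ← integral_sub hint hcubic]
  calc _ ≤ ∫ x, C / 24 * b ^ 4 * x ^ 4 ∂ν := by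
        rw [← Real.norm_eq_abs]
        refine norm_integral_le_of_norm_le ((hpow 4 le_rfl).const_mul _)
          (Filter.Eventually.of_forall fun x => ?_)
        have := abs_sub_cubic_taylor_le hψ hC a (x * b)
        rw [Real.norm_eq_abs]
        convert this using 1
        · congr 1; ring
        · ring
    _ ≤ C / 8 * b ^ 4 := by
        rw [integral_const_mul]
        have := mul_le_mul_of_nonneg_left hν.moment_four (by positivity : 0 ≤ C / 24 * b ^ 4)
        linarith

end Taylor

theorem matchesGaussianMoments_gaussianReal : MatchesGaussianMoments (gaussianReal 0 1) := by
  have hmem : MemLp (fun x : ℝ => x) 4 (gaussianReal 0 1) :=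
    memLp_id_gaussianReal' 4 (by norm_num)
  have hmom : ∀ k : ℕ, ∫ x, x ^ k ∂(gaussianReal 0 1) =
      iteratedDeriv k (fun t : ℝ => Real.exp (t ^ 2 / 2)) 0 := by
    intro k
    have h := iteratedDeriv_mgf_zero (X := id) (μ := gaussianReal 0 1)
      (by rw [integrableExpSet_id_gaussianReal]; simp) k
    rw [mgf_id_gaussianReal] at h
    simpa using h.symm
  have hderiv : ∀ p p' : ℝ → ℝ, (∀ t, HasDerivAt p (p' t) t) →
      deriv (fun t => p t * Real.exp (t ^ 2 / 2)) =
        fun t => (p' t + t * p t) * Real.exp (t ^ 2 / 2) := by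
    intro p p' hp
    funext t
    have he : HasDerivAt (fun t : ℝ => Real.exp (t ^ 2 / 2)) (Real.exp (t ^ 2 / 2) * t) t := by
      have := ((hasDerivAt_pow 2 t).div_const 2).exp
      simpa using this
    refine (((hp t).mul he).deriv).trans ?_
    ring
  have d0 : (fun t : ℝ => Real.exp (t ^ 2 / 2)) = fun t => 1 * Real.exp (t ^ 2 / 2) := by simp
  have d1 : iteratedDeriv 1 (fun t : ℝ => Real.exp (t ^ 2 / 2)) =
      fun t => t * Real.exp (t ^ 2 / 2) := by
    rw [iteratedDeriv_one, d0, hderiv (fun _ => 1) (fun _ => 0) (fun t => hasDerivAt_const t 1)]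
    simp
  have d2 : iteratedDeriv 2 (fun t : ℝ => Real.exp (t ^ 2 / 2)) =
      fun t => (1 + t ^ 2) * Real.exp (t ^ 2 / 2) := by
    rw [iteratedDeriv_succ, d1, hderiv (fun t => t) (fun _ => 1) (fun t => hasDerivAt_id t)]
    funext t; ring
  have d3 : iteratedDeriv 3 (fun t : ℝ => Real.exp (t ^ 2 / 2)) =
      fun t => (3 * t + t ^ 3) * Real.exp (t ^ 2 / 2) := by
    rw [iteratedDeriv_succ, d2, hderiv (fun t => 1 + t ^ 2) (fun t => 2 * t)
      (fun t => by simpa using (hasDerivAt_pow 2 t).const_add 1)]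
    funext t; ring
  have d4 : iteratedDeriv 4 (fun t : ℝ => Real.exp (t ^ 2 / 2)) =
      fun t => (3 + 6 * t ^ 2 + t ^ 4) * Real.exp (t ^ 2 / 2) := by
    rw [iteratedDeriv_succ, d3, hderiv (fun t => 3 * t + t ^ 3) (fun t => 3 + 3 * t ^ 2)
      (fun t => by
        have h := ((hasDerivAt_id' t).const_mul 3).fun_add (hasDerivAt_pow 3 t)
        simpa using h)]
    funext t; ring
  refine ⟨hmem, ?_, ?_, ?_, ?_⟩
  · simp
  · simpa [d2] using hmom 2
  · simpa [d3] using hmom 3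
  · simpa [d4] using (hmom 4).le

/-- The uniform probability measure on `Bool`. -/
noncomputable def uniformBool : Measure Bool :=
  (2⁻¹ : ENNReal) • Measure.count

instance : IsProbabilityMeasure uniformBool := by
  constructor
  have h : (Measure.count : Measure Bool) Set.univ = 2 := by
    rw [Measure.count_apply MeasurableSet.univ, Set.encard_univ]
    simp
  rw [uniformBool, Measure.smul_apply, h, smul_eq_mul]
  exact ENNReal.inv_mul_cancel (by norm_num) (by norm_num)

theorem uniformBool_singleton (b : Bool) : uniformBool {b} = 2⁻¹ := by
  simp [uniformBool]

/-- The Rademacher distribution on `ℝ`. -/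
noncomputable def rademacher : Measure ℝ :=
  uniformBool.map bR

theorem measurable_bR : Measurable bR := measurable_of_finite _

instance : IsProbabilityMeasure rademacher :=
  Measure.isProbabilityMeasure_map measurable_bR.aemeasurable

theorem integral_rademacher {f : ℝ → ℝ} (hf : Measurable f) :
    ∫ x, f x ∂rademacher = (f 1 + f (-1)) / 2 := by
  rw [rademacher, integral_map measurable_bR.aemeasurable hf.aestronglyMeasurable,
    integral_fintype .of_finite]
  simp [measureReal_def, uniformBool_singleton, bR]
  ring

theorem matchesGaussianMoments_rademacher : MatchesGaussianMoments rademacher := by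
  have hmem : MemLp (fun x : ℝ => x) 4 rademacher := by
    rw [rademacher, memLp_map_measure_iff (by fun_prop) measurable_bR.aemeasurable]
    exact MemLp.of_bound (measurable_bR.aestronglyMeasurable) 1
      (Filter.Eventually.of_forall fun b => by cases b <;> simp [bR])
  refine ⟨hmem, ?_, ?_, ?_, ?_⟩
  · rw [integral_rademacher (by fun_prop)]; norm_num
  · rw [integral_rademacher (by fun_prop)]; norm_num
  · rw [integral_rademacher (by fun_prop)]; norm_num
  · rw [integral_rademacher (by fun_prop)]; norm_num

theorem expect_eq_integral_pi_rademacher {n : ℕ} {f : (Fin n → ℝ) → ℝ} (hf : Measurable f) :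
    expect (fun x : Fin n → Bool => f fun i => bR (x i)) =
      ∫ g, f g ∂(Measure.pi fun _ : Fin n => rademacher) := by
  have hmap : (Measure.pi fun _ : Fin n => uniformBool).map (fun x i => bR (x i)) =
      Measure.pi fun _ : Fin n => rademacher :=
    Measure.pi_map_pi (fun _ => measurable_bR.aemeasurable)
      (hμ := fun _ => inferInstanceAs (SigmaFinite rademacher))
  rw [← hmap, integral_map (measurable_of_finite _).aemeasurable hf.aestronglyMeasurable,
    integral_fintype .of_finite]
  simp [measureReal_def, uniformBool_singleton, _root_.expect, ← Finset.mul_sum,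
    Measure.pi_singleton, div_eq_inv_mul]

section Multilinear

variable {ι : Type*} [Fintype ι]

/-- The multilinear polynomial with coefficients `c`, evaluated at `u`. -/
def multilinearEval (c : Finset ι → ℝ) (u : ι → ℝ) : ℝ :=
  ∑ S, c S * ∏ j ∈ S, u j

theorem measurable_multilinearEval (c : Finset ι → ℝ) : Measurable (multilinearEval c) := by
  unfold multilinearEval
  fun_prop

theorem memLp_four_prod_pi {ν : ι → Measure ℝ} [∀ i, IsProbabilityMeasure (ν i)]
    (hν : ∀ i, MatchesGaussianMoments (ν i)) (S : Finset ι) :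
    MemLp (fun u : ι → ℝ => ∏ j ∈ S, u j) 4 (Measure.pi ν) := by
  classical
  have hmeas : Measurable fun u : ι → ℝ => ∏ j ∈ S, u j := by fun_prop
  rw [← integrable_norm_rpow_iff hmeas.aestronglyMeasurable (by norm_num) (by norm_num)]
  have h : Integrable (fun u : ι → ℝ => ∏ j, if j ∈ S then u j ^ 4 else 1) (Measure.pi ν) := by
    refine Integrable.fintype_prod (f := fun j x => if j ∈ S then x ^ 4 else (1 : ℝ)) fun j => ?_
    by_cases hj : j ∈ S
    · simpa only [hj, if_true] using integrable_pow_of_memLp_four (hν j).memLp le_rfl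
    · simpa only [hj, if_false] using integrable_const (1 : ℝ)
  refine h.congr (Filter.Eventually.of_forall fun u => ?_)
  have h4 : (4 : ENNReal).toReal = (4 : ℕ) := by norm_num
  simp only [h4, Real.rpow_natCast, Real.norm_eq_abs]
  rw [Even.pow_abs ⟨2, rfl⟩, Finset.prod_ite_mem, Finset.univ_inter, Finset.prod_pow]

theorem memLp_four_multilinearEval {ν : ι → Measure ℝ} [∀ i, IsProbabilityMeasure (ν i)]
    (hν : ∀ i, MatchesGaussianMoments (ν i)) (c : Finset ι → ℝ) :
    MemLp (multilinearEval c) 4 (Measure.pi ν) := by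
  unfold multilinearEval
  exact memLp_finsetSum _ fun S _ => (memLp_four_prod_pi hν S).const_mul (c S)

variable [DecidableEq ι]

/-- The coefficients of the part of a multilinear polynomial not involving the variable `i`. -/
def coeffWithout (i : ι) (c : Finset ι → ℝ) (S : Finset ι) : ℝ :=
  if i ∈ S then 0 else c S

/-- The coefficients of the partial derivative in the variable `i` of a multilinear polynomial. -/
def coeffDeriv (i : ι) (c : Finset ι → ℝ) (S : Finset ι) : ℝ :=
  if i ∈ S then 0 else c (insert i S)

theorem sum_eq_sum_filter_notMem_add (i : ι) (f : Finset ι → ℝ) :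
    ∑ S, f S = ∑ S with i ∉ S, (f S + f (insert i S)) := by
  have h : (univ.filter fun S : Finset ι => i ∉ S) = (univ.erase i).powerset := by
    ext S
    simp [Finset.subset_erase]
  rw [h, Finset.sum_add_distrib, ← Finset.sum_powerset_insert (Finset.notMem_erase i univ),
    Finset.insert_erase (Finset.mem_univ i), Finset.powerset_univ]

theorem multilinearEval_eq_add (i : ι) (c : Finset ι → ℝ) (u : ι → ℝ) :
    multilinearEval c u =
      multilinearEval (coeffWithout i c) u + u i * multilinearEval (coeffDeriv i c) u := by
  simp only [multilinearEval, coeffWithout, coeffDeriv, ite_mul, zero_mul]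
  rw [sum_eq_sum_filter_notMem_add i, Finset.sum_add_distrib, Finset.mul_sum]
  simp only [mul_ite, mul_zero, ← ite_not (i ∈ _), Finset.sum_filter]
  congr 1
  refine Finset.sum_congr rfl fun S _ => ?_
  split_ifs with h
  · rfl
  · rw [Finset.prod_insert h]
    ring

theorem multilinearEval_update_of_forall_mem {i : ι} {c : Finset ι → ℝ} (hc : ∀ S, i ∈ S → c S = 0)
    (u : ι → ℝ) (x : ℝ) :
    multilinearEval c (Function.update u i x) = multilinearEval c u := by
  refine Finset.sum_congr rfl fun S _ => ?_
  by_cases hi : i ∈ S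
  · simp [hc S hi]
  · rw [Finset.prod_update_of_notMem hi]

theorem multilinearEval_coeffWithout_update (i : ι) (c : Finset ι → ℝ) (u : ι → ℝ) (x : ℝ) :
    multilinearEval (coeffWithout i c) (Function.update u i x) =
      multilinearEval (coeffWithout i c) u :=
  multilinearEval_update_of_forall_mem (fun _ hS => if_pos hS) u x

theorem multilinearEval_coeffDeriv_update (i : ι) (c : Finset ι → ℝ) (u : ι → ℝ) (x : ℝ) :
    multilinearEval (coeffDeriv i c) (Function.update u i x) =
      multilinearEval (coeffDeriv i c) u :=
  multilinearEval_update_of_forall_mem (fun _ hS => if_pos hS) u x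

theorem sum_pow_mul_sq_eq_add (i : ι) (c : Finset ι → ℝ) :
    ∑ S, 3 ^ S.card * c S ^ 2 = ∑ S : Finset ι, 3 ^ S.card * coeffWithout i c S ^ 2 +
      3 * ∑ S : Finset ι, 3 ^ S.card * coeffDeriv i c S ^ 2 := by
  rw [sum_eq_sum_filter_notMem_add i, Finset.sum_add_distrib, Finset.mul_sum]
  simp only [Finset.sum_filter]
  congr 1
  · refine Finset.sum_congr rfl fun S _ => ?_
    by_cases h : i ∈ S <;> simp [coeffWithout, h]
  · refine Finset.sum_congr rfl fun S _ => ?_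
    by_cases h : i ∈ S
    · simp [coeffDeriv, h]
    · simp [coeffDeriv, h]
      ring

theorem sum_coeffDeriv_sq (i : ι) (c : Finset ι → ℝ) :
    ∑ S, coeffDeriv i c S ^ 2 = ∑ S with i ∈ S, c S ^ 2 := by
  rw [Finset.sum_filter, sum_eq_sum_filter_notMem_add i fun S => if i ∈ S then c S ^ 2 else 0,
    Finset.sum_filter]
  refine Finset.sum_congr rfl fun S _ => ?_
  by_cases h : i ∈ S <;> simp [coeffDeriv, h]

section Product

variable {ν ν' : ι → Measure ℝ} [∀ i, IsProbabilityMeasure (ν i)]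
  [∀ i, IsProbabilityMeasure (ν' i)]

theorem measurePreserving_update_pi {i : ι} (h : ∀ j, j ≠ i → ν' j = ν j) :
    MeasurePreserving (fun p : (ι → ℝ) × ℝ => Function.update p.1 i p.2)
      ((Measure.pi ν').prod (ν i)) (Measure.pi ν) := by
  have hm : Measurable fun p : (ι → ℝ) × ℝ => Function.update p.1 i p.2 :=
    measurable_update'
  refine ⟨hm, (Measure.pi_eq fun s hs => ?_).symm⟩
  have hpre : (fun p : (ι → ℝ) × ℝ => Function.update p.1 i p.2) ⁻¹' Set.univ.pi s =
      Set.univ.pi (Function.update s i Set.univ) ×ˢ s i := by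
    ext ⟨g, x⟩
    simp only [Set.mem_preimage, Set.mem_univ_pi, Set.mem_prod]
    constructor
    · intro H
      refine ⟨fun j => ?_, by simpa using H i⟩
      rcases eq_or_ne j i with rfl | hj
      · simp
      · simpa [hj] using H j
    · rintro ⟨H, hx⟩ j
      rcases eq_or_ne j i with rfl | hj
      · simpa using hx
      · simpa [hj] using H j
  rw [Measure.map_apply hm (MeasurableSet.univ_pi hs), hpre, Measure.prod_prod, Measure.pi_pi,
    ← Finset.mul_prod_erase univ (fun j => ν j (s j)) (Finset.mem_univ i),
    ← Finset.mul_prod_erase univ _ (Finset.mem_univ i)]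
  simp only [Function.update_self, measure_univ, one_mul]
  rw [mul_comm]
  congr 1
  refine Finset.prod_congr rfl fun j hj => ?_
  rw [Function.update_of_ne (Finset.ne_of_mem_erase hj), h j (Finset.ne_of_mem_erase hj)]

theorem integral_pow_coord_mul_pi (i : ι) (k : ℕ) {F : (ι → ℝ) → ℝ} (hF : Measurable F)
    (hi : ∀ u x, F (Function.update u i x) = F u) :
    ∫ u, u i ^ k * F u ∂(Measure.pi ν) = (∫ x, x ^ k ∂(ν i)) * ∫ u, F u ∂(Measure.pi ν) := by
  have hmp := measurePreserving_update_pi (ν := ν) (ν' := ν) (i := i) fun _ _ => rfl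
  have hmeas : Measurable fun u : ι → ℝ => u i ^ k * F u := by fun_prop
  rw [← hmp.map_eq, integral_map hmp.aemeasurable hmeas.aestronglyMeasurable, hmp.map_eq]
  simp only [Function.update_self, hi]
  rw [mul_comm, ← integral_prod_mul]
  simp only [mul_comm]

end Product

section Hypercontractivity

variable {ν : ι → Measure ℝ} [∀ i, IsProbabilityMeasure (ν i)]

theorem integral_sq_mul_sq_le {Ω : Type*} [MeasurableSpace Ω] {μ : Measure Ω} {f g : Ω → ℝ}
    {a b : ℝ} (hf : MemLp f 4 μ) (hg : MemLp g 4 μ) (ha : 0 ≤ a) (hb : 0 ≤ b)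
    (hfa : ∫ x, f x ^ 4 ∂μ ≤ a ^ 2) (hgb : ∫ x, g x ^ 4 ∂μ ≤ b ^ 2) :
    ∫ x, f x ^ 2 * g x ^ 2 ∂μ ≤ a * b := by
  have hff : Integrable (fun x => f x ^ 4) μ := by
    simpa [pow_succ] using integrable_mul_mul_mul_of_memLp_four hf hf hf hf
  have hgg : Integrable (fun x => g x ^ 4) μ := by
    simpa [pow_succ] using integrable_mul_mul_mul_of_memLp_four hg hg hg hg
  have hfg : Integrable (fun x => f x ^ 2 * g x ^ 2) μ := by
    simpa [pow_succ, mul_assoc] using integrable_mul_mul_mul_of_memLp_four hf hf hg hg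
  have hdiscr := discrim_le_zero (a := ∫ x, f x ^ 4 ∂μ) (b := -(2 * ∫ x, f x ^ 2 * g x ^ 2 ∂μ))
    (c := ∫ x, g x ^ 4 ∂μ) fun t => by
      have h : 0 ≤ ∫ x, ((t * t) * f x ^ 4 - (2 * t) * (f x ^ 2 * g x ^ 2) + g x ^ 4) ∂μ :=
        integral_nonneg fun x => by
          have := sq_nonneg (t * f x ^ 2 - g x ^ 2)
          simp only [Pi.zero_apply]
          linarith
      have hsub : Integrable (fun x => (t * t) * f x ^ 4 - (2 * t) * (f x ^ 2 * g x ^ 2)) μ :=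
        (hff.const_mul _).sub (hfg.const_mul _)
      rw [integral_add hsub hgg, integral_sub (hff.const_mul _) (hfg.const_mul _),
        integral_const_mul, integral_const_mul] at h
      linarith
  have hg0 : 0 ≤ ∫ x, g x ^ 4 ∂μ := integral_nonneg fun x => by positivity
  refine le_of_sq_le_sq ?_ (mul_nonneg ha hb)
  rw [discrim] at hdiscr
  have := mul_le_mul hfa hgb hg0 (sq_nonneg a)
  linarith

theorem integral_add_coord_mul_pow_four_le (hν : ∀ i, MatchesGaussianMoments (ν i)) (i : ι)
    (c : Finset ι → ℝ) {a b : ℝ} (ha : 0 ≤ a) (hb : 0 ≤ b)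
    (hA : ∫ u, multilinearEval (coeffWithout i c) u ^ 4 ∂(Measure.pi ν) ≤ a ^ 2)
    (hB : ∫ u, multilinearEval (coeffDeriv i c) u ^ 4 ∂(Measure.pi ν) ≤ b ^ 2) :
    ∫ u, multilinearEval c u ^ 4 ∂(Measure.pi ν) ≤ (a + 3 * b) ^ 2 := by
  have hmA := memLp_four_multilinearEval hν (coeffWithout i c)
  have hmB := memLp_four_multilinearEval hν (coeffDeriv i c)
  have hmY : MemLp (fun u => u i * multilinearEval (coeffDeriv i c) u) 4 (Measure.pi ν) := by
    refine ((memLp_four_multilinearEval hν c).sub hmA).ae_eq (Filter.Eventually.of_forall fun u => ?_)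
    rw [Pi.sub_apply, multilinearEval_eq_add i c u, add_sub_cancel_left]
  have hAB := integral_sq_mul_sq_le hmA hmB ha hb hA hB
  have hA_upd := multilinearEval_coeffWithout_update i c
  have hB_upd := multilinearEval_coeffDeriv_update i c
  have hA_meas := measurable_multilinearEval (coeffWithout i c)
  have hB_meas := measurable_multilinearEval (coeffDeriv i c)
  have hexp := multilinearEval_eq_add i c
  generalize multilinearEval (coeffWithout i c) = A at *
  generalize multilinearEval (coeffDeriv i c) = B at *
  have i0 := integrable_mul_mul_mul_of_memLp_four hmA hmA hmA hmA
  have i1 := (integrable_mul_mul_mul_of_memLp_four hmA hmA hmA hmY).const_mul 4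
  have i2 := (integrable_mul_mul_mul_of_memLp_four hmA hmA hmY hmY).const_mul 6
  have i3 := (integrable_mul_mul_mul_of_memLp_four hmA hmY hmY hmY).const_mul 4
  have i4 := integrable_mul_mul_mul_of_memLp_four hmY hmY hmY hmY
  have e0 : Integrable (fun u => A u ^ 4) (Measure.pi ν) :=
    i0.congr (Filter.Eventually.of_forall fun u => by ring)
  have e1 : Integrable (fun u => 4 * (u i ^ 1 * (A u ^ 3 * B u))) (Measure.pi ν) :=
    i1.congr (Filter.Eventually.of_forall fun u => by ring)
  have e2 : Integrable (fun u => 6 * (u i ^ 2 * (A u ^ 2 * B u ^ 2))) (Measure.pi ν) :=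
    i2.congr (Filter.Eventually.of_forall fun u => by ring)
  have e3 : Integrable (fun u => 4 * (u i ^ 3 * (A u * B u ^ 3))) (Measure.pi ν) :=
    i3.congr (Filter.Eventually.of_forall fun u => by ring)
  have e4 : Integrable (fun u => u i ^ 4 * B u ^ 4) (Measure.pi ν) :=
    i4.congr (Filter.Eventually.of_forall fun u => by ring)
  have e01 : Integrable (fun u => A u ^ 4 + 4 * (u i ^ 1 * (A u ^ 3 * B u))) (Measure.pi ν) :=
    e0.add e1
  have e012 : Integrable (fun u => A u ^ 4 + 4 * (u i ^ 1 * (A u ^ 3 * B u)) +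
      6 * (u i ^ 2 * (A u ^ 2 * B u ^ 2))) (Measure.pi ν) := e01.add e2
  have e0123 : Integrable (fun u => A u ^ 4 + 4 * (u i ^ 1 * (A u ^ 3 * B u)) +
      6 * (u i ^ 2 * (A u ^ 2 * B u ^ 2)) + 4 * (u i ^ 3 * (A u * B u ^ 3))) (Measure.pi ν) :=
    e012.add e3
  have hB0 : 0 ≤ ∫ u, B u ^ 4 ∂(Measure.pi ν) := integral_nonneg fun u => by positivity
  have hB4 : (∫ x, x ^ 4 ∂(ν i)) * ∫ u, B u ^ 4 ∂(Measure.pi ν) ≤ 3 * b ^ 2 :=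
    mul_le_mul (hν i).moment_four hB hB0 (by norm_num)
  have hfun : ∀ u, multilinearEval c u ^ 4 = A u ^ 4 + 4 * (u i ^ 1 * (A u ^ 3 * B u)) +
      6 * (u i ^ 2 * (A u ^ 2 * B u ^ 2)) + 4 * (u i ^ 3 * (A u * B u ^ 3)) +
      u i ^ 4 * B u ^ 4 := fun u => by rw [hexp]; ring
  simp_rw [hfun]
  rw [integral_add e0123 e4, integral_add e012 e3, integral_add e01 e2, integral_add e0 e1,
    integral_const_mul, integral_const_mul, integral_const_mul,
    integral_pow_coord_mul_pi i 1 (by fun_prop) (by simp [hA_upd, hB_upd]),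
    integral_pow_coord_mul_pi i 2 (by fun_prop) (by simp [hA_upd, hB_upd]),
    integral_pow_coord_mul_pi i 3 (by fun_prop) (by simp [hA_upd, hB_upd]),
    integral_pow_coord_mul_pi i 4 (by fun_prop) (by simp [hB_upd])]
  simp only [pow_one, (hν i).moment_one, (hν i).moment_two, (hν i).moment_three]
  nlinarith [sq_nonneg b]

/-- `(4, 2)`-hypercontractivity for multilinear polynomials in independent variables. -/
theorem integral_multilinearEval_pow_four_le (hν : ∀ i, MatchesGaussianMoments (ν i))
    (c : Finset ι → ℝ) :
    ∫ u, multilinearEval c u ^ 4 ∂(Measure.pi ν) ≤ (∑ S, 3 ^ S.card * c S ^ 2) ^ 2 := by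
  suffices H : ∀ (I : Finset ι) (c : Finset ι → ℝ), (∀ S, ¬ S ⊆ I → c S = 0) →
      ∫ u, multilinearEval c u ^ 4 ∂(Measure.pi ν) ≤ (∑ S, 3 ^ S.card * c S ^ 2) ^ 2 from
    H univ c fun S hS => absurd (Finset.subset_univ S) hS
  intro I
  induction I using Finset.induction_on with
  | empty =>
    intro c hc
    have hc' : ∀ S, S ≠ ∅ → c S = 0 := fun S hS => hc S (by simpa using hS)
    have h1 : ∀ u, multilinearEval c u = c ∅ := fun u => by
      rw [multilinearEval, Finset.sum_eq_single ∅ (fun S _ hS => by simp [hc' S hS]) (by simp)]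
      simp
    rw [Finset.sum_eq_single ∅ (fun S _ hS => by simp [hc' S hS]) (by simp)]
    simp only [h1, integral_const, probReal_univ, smul_eq_mul]
    simp [← pow_mul]
  | insert i I hi ih =>
    intro c hc
    rw [sum_pow_mul_sq_eq_add i]
    refine integral_add_coord_mul_pow_four_le hν i c
      (Finset.sum_nonneg fun S _ => by positivity) (Finset.sum_nonneg fun S _ => by positivity)
      (ih _ fun S hS => ?_) (ih _ fun S hS => ?_)
    · by_cases h : i ∈ S
      · simp [coeffWithout, h]
      · rw [coeffWithout, if_neg h]
        exact hc S fun hS' => hS ((Finset.subset_insert_iff_of_notMem h).1 hS')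
    · by_cases h : i ∈ S
      · simp [coeffDeriv, h]
      · rw [coeffDeriv, if_neg h]
        exact hc _ fun hS' => hS ((Finset.insert_subset_insert_iff h).1 hS')

theorem integral_multilinearEval_pow_four_le_of_degree (hν : ∀ i, MatchesGaussianMoments (ν i))
    {c : Finset ι → ℝ} {d : ℕ} (hc : ∀ S : Finset ι, d < S.card → c S = 0) :
    ∫ u, multilinearEval c u ^ 4 ∂(Measure.pi ν) ≤ 9 ^ d * (∑ S, c S ^ 2) ^ 2 := by
  have h : ∑ S : Finset ι, 3 ^ S.card * c S ^ 2 ≤ 3 ^ d * ∑ S, c S ^ 2 := by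
    rw [Finset.mul_sum]
    refine Finset.sum_le_sum fun S _ => ?_
    rcases lt_or_ge d S.card with hS | hS
    · simp [hc S hS]
    · gcongr
      norm_num
  calc _ ≤ (∑ S : Finset ι, 3 ^ S.card * c S ^ 2) ^ 2 := integral_multilinearEval_pow_four_le hν c
    _ ≤ (3 ^ d * ∑ S, c S ^ 2) ^ 2 :=
        pow_le_pow_left₀ (Finset.sum_nonneg fun S _ => by positivity) h 2
    _ = 9 ^ d * (∑ S, c S ^ 2) ^ 2 := by
        rw [mul_pow, ← pow_mul, mul_comm d 2, pow_mul]
        norm_num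

end Hypercontractivity

section Replacement

variable {ψ : ℝ → ℝ} {C : ℝ} {ν ν' : ι → Measure ℝ} [∀ i, IsProbabilityMeasure (ν i)]
  [∀ i, IsProbabilityMeasure (ν' i)]

theorem integral_comp_multilinearEval_eq_integral_integral (hψ : ContDiff ℝ 4 ψ)
    (hC : ∀ x, |iteratedDeriv 4 ψ x| ≤ C) (hν : ∀ j, MatchesGaussianMoments (ν j)) {i : ι}
    (h : ∀ j, j ≠ i → ν' j = ν j) (c : Finset ι → ℝ) :
    Integrable (fun u => ∫ x, ψ (multilinearEval (coeffWithout i c) u +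
      x * multilinearEval (coeffDeriv i c) u) ∂(ν i)) (Measure.pi ν') ∧
    ∫ u, ψ (multilinearEval c u) ∂(Measure.pi ν) =
      ∫ u, ∫ x, ψ (multilinearEval (coeffWithout i c) u +
        x * multilinearEval (coeffDeriv i c) u) ∂(ν i) ∂(Measure.pi ν') := by
  have hmp := measurePreserving_update_pi h
  have hint := integrable_comp_of_memLp_four hψ hC (memLp_four_multilinearEval hν c)
  have hint' := (hmp.integrable_comp hint.1).2 hint
  have hcomp : ((fun u => ψ (multilinearEval c u)) ∘
      fun p : (ι → ℝ) × ℝ => Function.update p.1 i p.2) =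
      fun p => ψ (multilinearEval (coeffWithout i c) p.1 +
        p.2 * multilinearEval (coeffDeriv i c) p.1) := by
    funext p
    simp only [Function.comp_apply]
    rw [multilinearEval_eq_add i c, multilinearEval_coeffWithout_update,
      multilinearEval_coeffDeriv_update, Function.update_self]
  rw [hcomp] at hint'
  refine ⟨hint'.integral_prod_left, ?_⟩
  rw [← integral_prod _ hint', ← hcomp]
  conv_lhs => rw [← hmp.map_eq]
  rw [integral_map hmp.aemeasurable (by rw [hmp.map_eq]; exact hint.1)]
  rfl

theorem abs_integral_sub_integral_le_of_eq_off (hψ : ContDiff ℝ 4 ψ)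
    (hC : ∀ x, |iteratedDeriv 4 ψ x| ≤ C) (hν : ∀ j, MatchesGaussianMoments (ν j))
    (hν' : ∀ j, MatchesGaussianMoments (ν' j)) {i : ι}
    (h : ∀ j, j ≠ i → ν' j = ν j) (c : Finset ι → ℝ) :
    |∫ u, ψ (multilinearEval c u) ∂(Measure.pi ν) -
        ∫ u, ψ (multilinearEval c u) ∂(Measure.pi ν')| ≤
      C / 4 * ∫ u, multilinearEval (coeffDeriv i c) u ^ 4 ∂(Measure.pi ν') := by
  obtain ⟨hi, he⟩ := integral_comp_multilinearEval_eq_integral_integral hψ hC hν h c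
  obtain ⟨hi', he'⟩ := integral_comp_multilinearEval_eq_integral_integral hψ hC hν'
    (ν' := ν') (i := i) (fun _ _ => rfl) c
  rw [he, he', ← integral_sub hi hi', ← integral_const_mul, ← Real.norm_eq_abs]
  refine norm_integral_le_of_norm_le ((integrable_pow_of_memLp_four
    (memLp_four_multilinearEval hν' (coeffDeriv i c)) le_rfl).const_mul _)
    (Filter.Eventually.of_forall fun u => ?_)
  have h1 := abs_integral_comp_sub_quadratic_le hψ hC (hν i)
    (multilinearEval (coeffWithout i c) u) (multilinearEval (coeffDeriv i c) u)
  have h2 := abs_integral_comp_sub_quadratic_le hψ hC (hν' i)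
    (multilinearEval (coeffWithout i c) u) (multilinearEval (coeffDeriv i c) u)
  rw [Real.norm_eq_abs]
  rw [abs_le] at h1 h2 ⊢
  constructor <;> linarith [h1.1, h1.2, h2.1, h2.2]

/-- Replacing all the coordinate distributions costs at most the sum of the squared influences. -/
theorem abs_integral_pi_sub_integral_pi_le (hψ : ContDiff ℝ 4 ψ)
    (hC : ∀ x, |iteratedDeriv 4 ψ x| ≤ C) (hν : ∀ j, MatchesGaussianMoments (ν j))
    (hν' : ∀ j, MatchesGaussianMoments (ν' j)) {c : Finset ι → ℝ} {d : ℕ}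
    (hc : ∀ S : Finset ι, d < S.card → c S = 0) :
    |∫ u, ψ (multilinearEval c u) ∂(Measure.pi ν) -
        ∫ u, ψ (multilinearEval c u) ∂(Measure.pi ν')| ≤
      C / 4 * 9 ^ d * ∑ i, (∑ S with i ∈ S, c S ^ 2) ^ 2 := by
  have hC0 : 0 ≤ C := (abs_nonneg _).trans (hC 0)
  let hyb : Finset ι → ι → Measure ℝ := fun I j => if j ∈ I then ν j else ν' j
  have hprob : ∀ I j, IsProbabilityMeasure (hyb I j) := fun I j => by
    by_cases hj : j ∈ I <;> simp only [hyb, hj, if_true, if_false] <;> infer_instance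
  have hmom : ∀ I j, MatchesGaussianMoments (hyb I j) := fun I j => by
    by_cases hj : j ∈ I
    · simpa only [hyb, hj, if_true] using hν j
    · simpa only [hyb, hj, if_false] using hν' j
  suffices H : ∀ I : Finset ι, |∫ u, ψ (multilinearEval c u) ∂(Measure.pi (hyb I)) -
      ∫ u, ψ (multilinearEval c u) ∂(Measure.pi ν')| ≤
        C / 4 * 9 ^ d * ∑ i ∈ I, (∑ S with i ∈ S, c S ^ 2) ^ 2 by
    have huniv : hyb univ = ν := by funext j; simp [hyb]
    rw [← huniv]
    exact H univ
  intro I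
  induction I using Finset.induction_on with
  | empty =>
    have hempty : hyb ∅ = ν' := by funext j; simp [hyb]
    simp [hempty]
  | insert i I hi ih =>
    have hoff : ∀ j, j ≠ i → hyb I j = hyb (insert i I) j := fun j hj => by
      simp [hyb, Finset.mem_insert, hj]
    have hstep := abs_integral_sub_integral_le_of_eq_off hψ hC (hmom (insert i I)) (hmom I) hoff c
    have hderiv : ∀ S : Finset ι, d < S.card → coeffDeriv i c S = 0 := fun S hS => by
      rw [coeffDeriv]
      split_ifs
      · rfl
      · exact hc _ (hS.trans_le (Finset.card_le_card (Finset.subset_insert i S)))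
    have hhyper := integral_multilinearEval_pow_four_le_of_degree (hmom I) hderiv
    rw [sum_coeffDeriv_sq] at hhyper
    rw [Finset.sum_insert hi, mul_add]
    refine (abs_sub_le _ (∫ u, ψ (multilinearEval c u) ∂(Measure.pi (hyb I))) _).trans
      (add_le_add (hstep.trans ?_) ih)
    rw [mul_assoc]
    exact mul_le_mul_of_nonneg_left hhyper (by positivity)

end Replacement

theorem sum_influence_sq_le {c : Finset ι → ℝ} {d : ℕ}
    (hc : ∀ S : Finset ι, d < S.card → c S = 0) {τ : ℝ}
    (hτ : ∀ i, ∑ S with i ∈ S, c S ^ 2 ≤ τ) (hτ0 : 0 ≤ τ) :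
    ∑ i, (∑ S with i ∈ S, c S ^ 2) ^ 2 ≤ τ * (d * ∑ S with S ≠ ∅, c S ^ 2) := by
  have hinf : ∑ i, ∑ S with i ∈ S, c S ^ 2 ≤ d * ∑ S with S ≠ ∅, c S ^ 2 := by
    simp only [Finset.sum_filter]
    rw [Finset.sum_comm, Finset.mul_sum]
    refine Finset.sum_le_sum fun S _ => ?_
    rw [← Finset.sum_filter, Finset.sum_const, Finset.filter_univ_mem, nsmul_eq_mul]
    rcases eq_or_ne S ∅ with rfl | hne
    · simp
    · rw [if_pos hne]
      rcases lt_or_ge d S.card with hS | hS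
      · simp [hc S hS]
      · gcongr
  calc _ ≤ ∑ i, τ * ∑ S with i ∈ S, c S ^ 2 := by
        refine Finset.sum_le_sum fun i _ => ?_
        rw [sq]
        exact mul_le_mul_of_nonneg_right (hτ i) (Finset.sum_nonneg fun S _ => sq_nonneg _)
    _ ≤ _ := by
        rw [← Finset.mul_sum]
        exact mul_le_mul_of_nonneg_left hinf hτ0

end Multilinear

/-- **Hybrid argument for low-degree multilinear polynomials** (from the invariance
principle). If `Q = ∑_{|S| ≤ d} c_S ∏_{i∈S} uᵢ` satisfies `∑_{S ≠ ∅} c_S² = 1` with all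
influences at most `τ`, and `ψ` is `C⁴` with `|ψ⁽⁴⁾| ≤ C` everywhere, then
`|E[ψ(Q(X))] − E[ψ(Q(G))]| ≤ d · 9^d · C · τ` for `X` uniform on the cube and `G` a
standard Gaussian vector. -/
theorem invariance_hybrid_argument (n d : ℕ) (hd : 1 ≤ d) (c : Finset (Fin n) → ℝ)
    (hdeg : ∀ S : Finset (Fin n), d < S.card → c S = 0)
    (hnorm : ∑ S ∈ univ.filter (fun S : Finset (Fin n) => S ≠ ∅), c S ^ 2 = 1)
    (τ : ℝ)
    (hτ : IsGreatest (Set.range fun i : Fin n =>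
      ∑ S ∈ univ.filter (fun S : Finset (Fin n) => i ∈ S), c S ^ 2) τ)
    (ψ : ℝ → ℝ) (hψ : ContDiff ℝ 4 ψ) (C : ℝ)
    (hC : ∀ x, |iteratedDeriv 4 ψ x| ≤ C) :
    |(expect fun x : Fin n → Bool => ψ (∑ S : Finset (Fin n), c S * chi S x)) -
        ∫ g, ψ (∑ S : Finset (Fin n), c S * ∏ i ∈ S, g i) ∂(gaussianPi n)| ≤
      d * 9 ^ d * C * τ := by
  have hC0 : 0 ≤ C := (abs_nonneg _).trans (hC 0)
  have hτ_ub : ∀ i, ∑ S with i ∈ S, c S ^ 2 ≤ τ := fun i => hτ.2 ⟨i, rfl⟩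
  have hτ0 : 0 ≤ τ := by
    obtain ⟨i, hi⟩ := hτ.1
    rw [← hi]
    exact Finset.sum_nonneg fun S _ => sq_nonneg _
  have hmeas : Measurable fun g : Fin n → ℝ => ψ (multilinearEval c g) :=
    hψ.continuous.measurable.comp (measurable_multilinearEval c)
  have hsum := sum_influence_sq_le hdeg hτ_ub hτ0
  rw [hnorm, mul_one] at hsum
  have hmain := abs_integral_pi_sub_integral_pi_le hψ hC (ν := fun _ : Fin n => rademacher)
    (ν' := fun _ : Fin n => gaussianReal 0 1) (fun _ => matchesGaussianMoments_rademacher)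
    (fun _ => matchesGaussianMoments_gaussianReal) hdeg
  rw [← expect_eq_integral_pi_rademacher hmeas] at hmain
  refine hmain.trans ?_
  calc C / 4 * 9 ^ d * ∑ i, (∑ S with i ∈ S, c S ^ 2) ^ 2
      ≤ C / 4 * 9 ^ d * (τ * d) := by gcongr
    _ ≤ d * 9 ^ d * C * τ := by
        have : 0 ≤ d * 9 ^ d * C * τ := by positivity
        linarith
end
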